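/- arXiv:1807.10098 — 2 statements merged into one kernel-verified Lean document; each statement's English description precedes it below -/
import Mathlib

section
/- As γ → +∞ we have: (i) there exists C > 0 such that |u_γ(r) − (γ − t_γ(r)/γ + a S_γ(r)/γ²)| ≤ C t_γ(r)/γ³ for all r ∈ [0, ρ_γ] and all sufficiently large γ; (ii) ∫_{B₀(ρ_γ)} Δu_γ dy = 4π/γ + 2πa/γ² + O(γ^{−3}); and (iii) ∫_{B₀(ρ_γ)} u_γ Δu_γ dy = 4π + o(1). -/
open Real Set Filter MeasureTheory Topology

noncomputable section

/-- The radial Laplacian with the sign convention Δ = −div(∇·):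
for a radial C² function, (Δu)(r) = −u''(r) − u'(r)/r. -/
def radLap (u : ℝ → ℝ) (r : ℝ) : ℝ := -(deriv (deriv u) r) - deriv u r / r

/-- `GCtx a c0 g` : a > 0, c₀ > 0, g is continuous and positive on [0,∞), and
g(t) = exp(t² − at) for all t ≥ c₀ (hypotheses (G1)-(G2) of the paper). -/
def GCtx (a c0 : ℝ) (g : ℝ → ℝ) : Prop :=
  0 < a ∧ 0 < c0 ∧ ContinuousOn g (Set.Ici 0) ∧ (∀ t : ℝ, 0 ≤ t → 0 < g t) ∧
    ∀ t : ℝ, c0 ≤ t → g t = Real.exp (t ^ 2 - a * t)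

/-- `IsGSol g beta gam u` : u is a smooth radial function on the closed unit disk,
positive in the open disk, vanishing on the boundary, with central value γ, solving
Δu = β u g(u) in Ω (radially). -/
def IsGSol (g : ℝ → ℝ) (beta gam : ℝ) (u : ℝ → ℝ) : Prop :=
  ContDiffOn ℝ (⊤ : ℕ∞) u (Set.Icc 0 1) ∧
    (∀ r ∈ Set.Ioo (0:ℝ) 1, radLap u r = beta * u r * g (u r)) ∧
    (∀ r ∈ Set.Ico (0:ℝ) 1, 0 < u r) ∧ u 1 = 0 ∧ u 0 = gam

/-- Dirichlet energy ∫_Ω |∇u|² dy of a radial function, = ∫₀¹ u'(r)² 2πr dr. -/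
def dirEnergy (u : ℝ → ℝ) : ℝ := ∫ r in Set.Ioo (0:ℝ) 1, (deriv u r) ^ 2 * (2 * π * r)

/-- t_γ(r) = T₀(r/μ_γ) = log(1 + r²/μ_γ²). -/
def tG (μγ r : ℝ) : ℝ := Real.log (1 + r ^ 2 / μγ ^ 2)

/-- S_γ(r) = S₀(r/μ_γ) where S₀(x) = −T₀(x)/2 + |x|²/(2(1+|x|²)). -/
def sG (μγ r : ℝ) : ℝ :=
  -(tG μγ r) / 2 + (r ^ 2 / μγ ^ 2) / (2 * (1 + r ^ 2 / μγ ^ 2))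

theorem eventually_lt_of_hasDerivWithinAt_pos {f : ℝ → ℝ} {f' x : ℝ}
    (hf : HasDerivWithinAt f f' (Ici x) x) (h : 0 < f') : ∀ᶠ y in 𝓝[>] x, f x < f y := by
  have h1 := (hasDerivWithinAt_iff_tendsto_slope' (self_notMem_Ioi)).1 hf.Ioi_of_Ici
  filter_upwards [h1.eventually (lt_mem_nhds h), self_mem_nhdsWithin] with y hy hxy
  rw [slope_def_field] at hy
  have hxy' : (0 : ℝ) < y - x := sub_pos.2 hxy
  have := (div_pos_iff_of_pos_right hxy').1 hy
  linarith

/-- A continuation principle: a function cannot cross the barrier `Q` as long as staying below the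
barrier up to time `t` forces the strict inequality between derivatives at time `t`. -/
theorem abs_le_of_abs_deriv_lt_of_forall_abs_le {q Q q' Q' : ℝ → ℝ} {T : ℝ}
    (hq : ContinuousOn q (Icc 0 T)) (h0 : |q 0| ≤ Q 0)
    (hq' : ∀ t ∈ Ico 0 T, HasDerivWithinAt q (q' t) (Ici t) t)
    (hQ' : ∀ t, HasDerivAt Q (Q' t) t)
    (hb : ∀ t ∈ Ico 0 T, (∀ s ∈ Icc 0 t, |q s| ≤ Q s) → |q' t| < Q' t) :
    ∀ t ∈ Icc 0 T, |q t| ≤ Q t := by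
  by_contra! hcon
  obtain ⟨t₁, ht₁, hbad⟩ := hcon
  set B : Set ℝ := {t | t ∈ Icc 0 T ∧ Q t < |q t|} with hB
  have hne : B.Nonempty := ⟨t₁, ht₁, hbad⟩
  have hbdd : BddBelow B := ⟨0, fun t ht => ht.1.1⟩
  set m := sInf B with hm
  have hm0 : 0 ≤ m := le_csInf hne fun t ht => ht.1.1
  have hm1 : m ≤ t₁ := csInf_le hbdd ⟨ht₁, hbad⟩
  have hmT : m ≤ T := hm1.trans ht₁.2
  have hQc : Continuous Q := continuous_iff_continuousAt.2 fun t => (hQ' t).continuousAt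
  have hlt : ∀ s ∈ Ico 0 m, |q s| ≤ Q s := by
    intro s hs
    by_contra! h
    exact absurd (csInf_le hbdd (show s ∈ B from ⟨⟨hs.1, hs.2.le.trans hmT⟩, h⟩)) (not_le.2 hs.2)
  have hmm : |q m| ≤ Q m := by
    rcases hm0.eq_or_lt with h | h
    · rw [← h]; exact h0
    · have hne' : (𝓝[Ico 0 m] m).NeBot := by
        rw [← mem_closure_iff_nhdsWithin_neBot, closure_Ico h.ne]
        exact ⟨hm0, le_rfl⟩
      have hc : Tendsto q (𝓝[Ico 0 m] m) (𝓝 (q m)) :=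
        (hq m ⟨hm0, hmT⟩).mono_left
          (nhdsWithin_mono _ (Ico_subset_Icc_self.trans (Icc_subset_Icc_right hmT)))
      exact le_of_tendsto_of_tendsto hc.abs (hQc.continuousAt.mono_left nhdsWithin_le_nhds)
        (eventually_nhdsWithin_of_forall hlt)
  have hall : ∀ s ∈ Icc 0 m, |q s| ≤ Q s := by
    intro s hs
    rcases hs.2.eq_or_lt with h | h
    · rw [h]; exact hmm
    · exact hlt s ⟨hs.1, h⟩
  have hmT' : m < T := by
    refine lt_of_le_of_ne hmT fun h => ?_
    have : t₁ = m := le_antisymm (ht₁.2.trans h.ge) hm1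
    rw [this] at hbad
    exact absurd hmm (not_le.2 hbad)
  have hd := abs_lt.1 (hb m ⟨hm0, hmT'⟩ hall)
  have hqm := hq' m ⟨hm0, hmT'⟩
  have hQm := (hQ' m).hasDerivWithinAt (s := Ici m)
  have e1 := eventually_lt_of_hasDerivWithinAt_pos (hQm.sub hqm) (by linarith [hd.2])
  have e2 := eventually_lt_of_hasDerivWithinAt_pos (hQm.add hqm) (by linarith [hd.1])
  have e3 : ∀ᶠ y in 𝓝[>] m, |q y| ≤ Q y := by
    have := abs_le.1 hmm
    filter_upwards [e1, e2] with y h1 h2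
    simp only [Pi.sub_apply, Pi.add_apply] at h1 h2
    exact abs_le.2 ⟨by linarith, by linarith⟩
  obtain ⟨z, hz, hzs⟩ := (mem_nhdsGT_iff_exists_Ioo_subset).1 e3
  obtain ⟨y, hyB, hyz⟩ := exists_lt_of_csInf_lt hne (show sInf B < z from hz)
  rcases (csInf_le hbdd hyB).eq_or_lt with h | h
  · exact absurd (h ▸ hmm) (not_le.2 hyB.2)
  · exact absurd (hzs ⟨h, hyz⟩) (not_le.2 hyB.2)

theorem abs_exp_sub_one_sub_le {x y : ℝ} (hxy : x ≤ y) (hy : 0 ≤ y) :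
    |exp x - 1 - x| ≤ x ^ 2 * exp y := by
  have h1 := add_one_le_exp x
  have h2 : exp x - 1 ≤ x * exp x := by
    have h3 := add_one_le_exp (-x)
    have h4 : exp x * exp (-x) = 1 := by rw [← exp_add]; simp
    nlinarith [exp_pos x]
  have hey : 1 ≤ exp y := one_le_exp hy
  have hexy : exp x ≤ exp y := exp_le_exp.2 hxy
  rw [abs_of_nonneg (by linarith)]
  have h3 : exp x - 1 - x ≤ x * (exp x - 1) := by linarith
  rcases le_total 0 x with hx | hx
  · nlinarith [mul_le_mul_of_nonneg_left h2 hx, mul_le_mul_of_nonneg_left hexy (sq_nonneg x)]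
  · nlinarith [mul_le_mul_of_nonneg_left hey (sq_nonneg x)]

theorem self_le_one_sub_exp_neg_mul {t : ℝ} (ht : 0 ≤ t) : t ≤ (1 - exp (-t)) * (1 + t) := by
  have h3 := add_one_le_exp t
  have h4 : exp t * exp (-t) = 1 := by rw [← exp_add]; simp
  nlinarith [exp_pos (-t)]

theorem abs_sub_le_of_abs_error_le {a b ε t w : ℝ} (ha : 0 < a) (hb : b = a / 2 + 1) (hε : 0 < ε)
    (ht : 0 ≤ t) (he : |w - t - a * ε / 2 * (t - 1 + exp (-t))| ≤ ε * t) :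
    |w - t| ≤ b * (ε * t) := by
  have hE1 : exp (-t) ≤ 1 := exp_le_one_iff.2 (by linarith)
  have hE2 : 0 ≤ t - 1 + exp (-t) := by have := add_one_le_exp (-t); linarith
  have h0 : 0 ≤ a * ε / 2 * (t - 1 + exp (-t)) := by positivity
  have h1 : a * ε / 2 * (t - 1 + exp (-t)) ≤ a * ε / 2 * t := by gcongr; linarith
  have h2 := abs_le.1 he
  rw [hb]
  exact abs_le.2 ⟨by nlinarith [mul_nonneg hε.le ht], by linarith⟩

set_option maxHeartbeats 400000 in
/-- The profile driving the equation: with `w = γ (γ - u)` and `ε = 1 / γ`, the source term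
differs from its first order expansion around `w = t` by a linear term in the error and by an
exponentially decaying term of order `ε ^ 2`. -/
theorem source_error_bound {a b ε t w : ℝ} (ha : 0 < a) (hb : b = a / 2 + 1) (hε : 0 < ε)
    (hεb : 100 * b * ε ≤ 1) (ht : 0 ≤ t) (htε : ε ^ 2 * t ≤ 1 / 2)
    (he : |w - t - a * ε / 2 * (t - 1 + exp (-t))| ≤ ε * t) :
    |(1 - ε ^ 2 * w) * exp (t - 2 * w + ε ^ 2 * w ^ 2 + a * ε * w) - exp (-t)
        - a * ε * (1 - exp (-t)) * exp (-t)|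
      ≤ 2 * exp (-t) * |w - t - a * ε / 2 * (t - 1 + exp (-t))|
        + 40 * 32 ^ 4 * b ^ 2 * ε ^ 2 * ((1 - exp (-t)) * exp (-t / 8)) := by
  set e := w - t - a * ε / 2 * (t - 1 + exp (-t)) with hedef
  set E := exp (-t) with hE
  have hE0 : 0 < E := exp_pos _
  have hE1 : E ≤ 1 := exp_le_one_iff.2 (by linarith)
  have hb1 : 1 ≤ b := by linarith
  have hεt : 0 ≤ ε * t := by positivity
  obtain ⟨v, hv⟩ : ∃ v, v = w - t := ⟨_, rfl⟩
  have hvabs : |v| ≤ b * (ε * t) := hv ▸ abs_sub_le_of_abs_error_le ha hb hε ht he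
  have hbεt : b * (ε * t) ≤ t / 100 := by nlinarith
  have hv' := abs_le.1 hvabs
  have hw0 : 0 ≤ w := by linarith
  have hw1 : w ≤ 101 / 100 * t := by linarith
  have hε1 : ε ≤ 1 / 100 := by nlinarith
  have hw2 : w ^ 2 ≤ (101 / 100) ^ 2 * t ^ 2 := by rw [← mul_pow]; gcongr
  have hεw2 : ε ^ 2 * w ^ 2 ≤ 6 / 10 * t := by
    calc ε ^ 2 * w ^ 2 ≤ ε ^ 2 * ((101 / 100) ^ 2 * t ^ 2) := by gcongr
      _ = (101 / 100) ^ 2 * t * (ε ^ 2 * t) := by ring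
      _ ≤ (101 / 100) ^ 2 * t * (1 / 2) := by gcongr
      _ ≤ _ := by linarith
  have hεw2' : ε ^ 2 * w ^ 2 ≤ 2 * ε ^ 2 * t ^ 2 := by
    have : w ^ 2 ≤ 2 * t ^ 2 := by nlinarith [sq_nonneg t]
    nlinarith [sq_nonneg ε]
  have hεw20 : 0 ≤ ε ^ 2 * w ^ 2 := by positivity
  have haw : a * ε * w ≤ 4 * b * (ε * t) := by
    have : a * ε * w ≤ a * ε * (101 / 100 * t) := by gcongr
    have : a * (ε * t) ≤ 2 * b * (ε * t) := by gcongr; linarith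
    linarith
  have haw0 : 0 ≤ a * ε * w := by positivity
  obtain ⟨X, hX⟩ : ∃ X, X = -2 * v + ε ^ 2 * w ^ 2 + a * ε * w := ⟨_, rfl⟩
  have hexp : exp (t - 2 * w + ε ^ 2 * w ^ 2 + a * ε * w) = E * exp X := by
    rw [hE, ← exp_add, hX, hv]; ring_nf
  have hX34 : X ≤ 3 / 4 * t := by rw [hX]; linarith
  have hXabs : |X| ≤ 6 * b * ε * (t * (1 + t)) := by
    have h2 : 2 * ε ^ 2 * t ^ 2 ≤ b * ε * t ^ 2 := by
      have : 2 * ε ^ 2 ≤ b * ε := by nlinarith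
      gcongr
    have h3 : 0 ≤ b * ε * t ^ 2 := by positivity
    rw [hX]
    exact abs_le.2 ⟨by linarith, by linarith⟩
  have hX2 : X ^ 2 ≤ 36 * b ^ 2 * ε ^ 2 * (t * (1 + t)) ^ 2 := by
    calc X ^ 2 = |X| ^ 2 := (sq_abs X).symm
      _ ≤ (6 * b * ε * (t * (1 + t))) ^ 2 := by gcongr
      _ = _ := by ring
  have hR1 := abs_exp_sub_one_sub_le hX34 (by positivity)
  set G := exp (3 / 4 * t) with hG
  have hG1 : 1 ≤ G := one_le_exp (by positivity)
  have hR1' : |exp X - 1 - X| ≤ 36 * b ^ 2 * ε ^ 2 * (t * (1 + t)) ^ 2 * G :=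
    hR1.trans (by gcongr)
  have hR2 : |ε ^ 2 * w ^ 2 + a * ε * v| ≤ (2 * ε ^ 2 * t ^ 2 + 2 * b ^ 2 * ε ^ 2 * t) * G := by
    have h1 : |a * ε * v| ≤ 2 * b ^ 2 * ε ^ 2 * t := by
      rw [abs_mul, abs_of_pos (by positivity : 0 < a * ε)]
      calc a * ε * |v| ≤ (2 * b) * ε * (b * (ε * t)) := by gcongr; linarith
        _ = _ := by ring
    have h2 : 0 ≤ 2 * ε ^ 2 * t ^ 2 + 2 * b ^ 2 * ε ^ 2 * t := by positivity
    calc _ ≤ |ε ^ 2 * w ^ 2| + |a * ε * v| := abs_add_le _ _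
      _ ≤ 2 * ε ^ 2 * t ^ 2 + 2 * b ^ 2 * ε ^ 2 * t := by rw [abs_of_nonneg hεw20]; linarith
      _ ≤ _ := le_mul_of_one_le_right h2 hG1
  have hR3 : |ε ^ 2 * w * exp X| ≤ 2 * ε ^ 2 * t * G := by
    rw [abs_of_nonneg (by positivity)]
    have : exp X ≤ G := exp_le_exp.2 hX34
    have : w ≤ 2 * t := by linarith
    calc ε ^ 2 * w * exp X ≤ ε ^ 2 * (2 * t) * G := by gcongr
      _ = _ := by ring
  have hpoly : 36 * b ^ 2 * ε ^ 2 * (t * (1 + t)) ^ 2 * G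
      + (2 * ε ^ 2 * t ^ 2 + 2 * b ^ 2 * ε ^ 2 * t) * G + 2 * ε ^ 2 * t * G
      ≤ 40 * b ^ 2 * ε ^ 2 * (t * (1 + t) ^ 3) * G := by
    have hb2 : 1 ≤ b ^ 2 := by nlinarith
    have h1 : 36 * b ^ 2 * (t * (1 + t)) ^ 2 + (2 * t ^ 2 + 2 * b ^ 2 * t) + 2 * t
        ≤ 40 * b ^ 2 * (t * (1 + t) ^ 3) := by
      have h2 : 2 * t ^ 2 + 2 * t ≤ b ^ 2 * (2 * t ^ 2 + 2 * t) :=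
        le_mul_of_one_le_left (by positivity) hb2
      have h3 : 0 ≤ b ^ 2 * (40 * (t * (1 + t) ^ 3) - 36 * (t * (1 + t)) ^ 2 - 2 * t ^ 2
          - 4 * t) := by
        have : 40 * (t * (1 + t) ^ 3) - 36 * (t * (1 + t)) ^ 2 - 2 * t ^ 2
          - 4 * t = 4 * t ^ 4 + 48 * t ^ 3 + 82 * t ^ 2 + 36 * t := by ring
        rw [this]; positivity
      linarith
    have := mul_le_mul_of_nonneg_left h1 (by positivity : 0 ≤ ε ^ 2 * G)
    linarith
  have hdecay : E * (40 * b ^ 2 * ε ^ 2 * (t * (1 + t) ^ 3) * G)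
      ≤ 40 * 32 ^ 4 * b ^ 2 * ε ^ 2 * ((1 - E) * exp (-t / 8)) := by
    have h1 : 1 + t ≤ 32 * exp (t / 32) := by have := add_one_le_exp (t / 32); linarith
    have h2 : (1 + t) ^ 4 ≤ 32 ^ 4 * exp (t / 8) := by
      calc (1 + t) ^ 4 ≤ (32 * exp (t / 32)) ^ 4 := by gcongr
        _ = _ := by rw [mul_pow, ← exp_nat_mul]; congr 2; push_cast; ring
    have h3 : exp (t / 8) * E * G = exp (-t / 8) := by
      rw [hE, hG, ← exp_add, ← exp_add]; congr 1; ring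
    have h4 : t * (1 + t) ^ 3 ≤ (1 - E) * (32 ^ 4 * exp (t / 8)) := by
      calc t * (1 + t) ^ 3 ≤ ((1 - E) * (1 + t)) * (1 + t) ^ 3 := by
            gcongr; exact self_le_one_sub_exp_neg_mul ht
        _ = (1 - E) * (1 + t) ^ 4 := by ring
        _ ≤ _ := by gcongr
    calc E * (40 * b ^ 2 * ε ^ 2 * (t * (1 + t) ^ 3) * G)
        ≤ E * (40 * b ^ 2 * ε ^ 2 * ((1 - E) * (32 ^ 4 * exp (t / 8))) * G) := by gcongr
      _ = 40 * 32 ^ 4 * b ^ 2 * ε ^ 2 * ((1 - E) * (exp (t / 8) * E * G)) := by ring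
      _ = _ := by rw [h3]
  have hid : (1 - ε ^ 2 * w) * exp (t - 2 * w + ε ^ 2 * w ^ 2 + a * ε * w) - E
        - a * ε * (1 - E) * E
      = E * (-2 * e + ((exp X - 1 - X) + (ε ^ 2 * w ^ 2 + a * ε * v) - ε ^ 2 * w * exp X)) := by
    rw [hexp]
    have h1 : e = v - a * ε / 2 * (t - 1 + E) := by linarith
    rw [h1]
    have h2 : w = t + v := by linarith
    have h3 : X = -2 * v + ε ^ 2 * w ^ 2 + a * ε * (t + v) := by rw [hX, h2]
    linear_combination E * h3
  rw [hid, abs_mul, abs_of_pos hE0]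
  have hsum : |(-2 * e + ((exp X - 1 - X) + (ε ^ 2 * w ^ 2 + a * ε * v) - ε ^ 2 * w * exp X))|
      ≤ 2 * |e| + 40 * b ^ 2 * ε ^ 2 * (t * (1 + t) ^ 3) * G := by
    calc _ ≤ |-2 * e| + |(exp X - 1 - X) + (ε ^ 2 * w ^ 2 + a * ε * v) - ε ^ 2 * w * exp X| :=
          abs_add_le _ _
      _ ≤ |-2 * e| + (|(exp X - 1 - X) + (ε ^ 2 * w ^ 2 + a * ε * v)| + |ε ^ 2 * w * exp X|) := by
          gcongr; exact abs_sub _ _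
      _ ≤ |-2 * e| + (|exp X - 1 - X| + |ε ^ 2 * w ^ 2 + a * ε * v| + |ε ^ 2 * w * exp X|) := by
          gcongr; exact abs_add_le _ _
      _ ≤ _ := by
          have : |-2 * e| = 2 * |e| := by rw [abs_mul, abs_neg, abs_two]
          linarith
  calc _ ≤ E * (2 * |e| + 40 * b ^ 2 * ε ^ 2 * (t * (1 + t) ^ 3) * G) := by gcongr
    _ ≤ _ := by linarith

theorem barrier_deriv_gt {E F t : ℝ} (ht : 0 ≤ t) (hE : E = exp (-t)) (hF : F = exp (-t / 8)) :
    2 * E * t ≤ 3 * ((1 - E) * F) := by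
  have h1 := self_le_one_sub_exp_neg_mul ht
  have h2 : 1 + t ≤ 8 / 7 * exp (7 / 8 * t) := by
    have := add_one_le_exp (7 / 8 * t); linarith
  have h3 : exp (7 / 8 * t) * E = F := by rw [hE, hF, ← exp_add]; congr 1; ring
  have hE0 : 0 < E := hE ▸ exp_pos _
  have hE1 : E ≤ 1 := by rw [hE]; exact exp_le_one_iff.2 (by linarith)
  rw [← hE] at h1
  have hF0 : 0 < F := hF ▸ exp_pos _
  have h4 : 0 ≤ (1 - E) * F := mul_nonneg (by linarith) hF0.le
  calc 2 * E * t ≤ 2 * E * ((1 - E) * (1 + t)) := by gcongr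
    _ ≤ 2 * E * ((1 - E) * (8 / 7 * exp (7 / 8 * t))) := by
        have : 0 ≤ 1 - E := by linarith
        gcongr
    _ = 16 / 7 * ((1 - E) * (exp (7 / 8 * t) * E)) := by ring
    _ ≤ _ := by rw [h3]; linarith

/-- The asymptotic expansion for the radial equation written in the logarithmic variable `t`, where
`w = γ (γ - u)`, `P` is the normalised flux and `ε = 1 / γ`. -/
theorem log_variable_expansion {a b ε K T : ℝ} {w P D : ℝ → ℝ} (ha : 0 < a) (hb : b = a / 2 + 1)
    (hε : 0 < ε) (hεb : 100 * b * ε ≤ 1) (hK : K = 40 * 32 ^ 4 * b ^ 2)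
    (hεK : K * exp 32 * ε ≤ 1) (hT : ε ^ 2 * T ≤ 1 / 2)
    (hw : ContinuousOn w (Icc 0 T)) (hP : ContinuousOn P (Icc 0 T)) (hw0 : w 0 = 0) (hP0 : P 0 = 0)
    (hw' : ∀ t ∈ Ioo 0 T, HasDerivAt w (P t / (1 - exp (-t))) t)
    (hP' : ∀ t ∈ Ico 0 T, HasDerivWithinAt P (D t) (Ici t) t)
    (hD : ∀ t ∈ Ico 0 T, w t ≤ 11 / 10 * t → D t =
      (1 - ε ^ 2 * w t) * exp (t - 2 * w t + ε ^ 2 * w t ^ 2 + a * ε * w t)) :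
    ∀ t ∈ Icc 0 T, |w t - t - a * ε / 2 * (t - 1 + exp (-t))| ≤ K * exp 32 * ε ^ 2 * t ∧
      |P t - (1 - exp (-t)) - a * ε / 2 * (1 - exp (-t)) ^ 2| ≤ K * exp 32 * ε ^ 2 := by
  have hb1 : 1 ≤ b := by linarith
  have hK0 : 0 < K := by rw [hK]; positivity
  set Ψ : ℝ → ℝ := fun t => exp (32 * (1 - exp (-t / 8))) with hΨ
  have hΨ0 : ∀ t, 0 < Ψ t := fun t => exp_pos _
  have hΨmono : Monotone Ψ := by
    intro s t hst
    refine exp_le_exp.2 ?_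
    have : exp (-t / 8) ≤ exp (-s / 8) := exp_le_exp.2 (by linarith)
    linarith
  have hΨ1 : ∀ t, 0 ≤ t → 1 ≤ Ψ t := fun t ht => by
    refine one_le_exp ?_
    have : exp (-t / 8) ≤ 1 := exp_le_one_iff.2 (by linarith)
    linarith
  have hΨ32 : ∀ t, Ψ t ≤ exp 32 := fun t => by
    refine exp_le_exp.2 ?_
    have := exp_pos (-t / 8)
    linarith
  have hdE : ∀ t : ℝ, HasDerivAt (fun t : ℝ => exp (-t)) (-exp (-t)) t := fun t => by
    simpa using (hasDerivAt_neg t).exp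
  have hdF : ∀ t : ℝ, HasDerivAt (fun t : ℝ => exp (-t / 8)) (-exp (-t / 8) / 8) t := fun t => by
    have := ((hasDerivAt_neg t).div_const 8).exp
    exact this.congr_deriv (by ring)
  have hdΨ : ∀ t, HasDerivAt Ψ (4 * exp (-t / 8) * Ψ t) t := fun t => by
    have := (((hdF t).const_sub 1).const_mul 32).exp
    exact this.congr_deriv (by simp only [hΨ]; ring)
  set e : ℝ → ℝ := fun t => w t - t - a * ε / 2 * (t - 1 + exp (-t)) with he
  set q : ℝ → ℝ := fun t => P t - (1 - exp (-t)) - a * ε / 2 * (1 - exp (-t)) ^ 2 with hq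
  set Q : ℝ → ℝ := fun t => K * ε ^ 2 * ((1 - exp (-t)) * Ψ t) with hQ
  have hec : ContinuousOn e (Icc 0 T) := by
    have : Continuous fun t : ℝ => a * ε / 2 * (t - 1 + exp (-t)) := by fun_prop
    exact (hw.sub continuousOn_id).sub this.continuousOn
  have hqc : ContinuousOn q (Icc 0 T) := by
    have h1 : Continuous fun t : ℝ => 1 - exp (-t) := by fun_prop
    have h2 : Continuous fun t : ℝ => a * ε / 2 * (1 - exp (-t)) ^ 2 := by fun_prop
    exact (hP.sub h1.continuousOn).sub h2.continuousOn
  have he0 : e 0 = 0 := by simp [he, hw0]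
  have hq0 : q 0 = 0 := by simp [hq, hP0]
  have he' : ∀ t ∈ Ioo 0 T, HasDerivAt e (q t / (1 - exp (-t))) t := by
    intro t ht
    have hne : 1 - exp (-t) ≠ 0 := by
      have : exp (-t) < 1 := exp_lt_one_iff.2 (by linarith [ht.1])
      linarith
    have := ((hw' t ht).sub (hasDerivAt_id t)).sub
      ((((hasDerivAt_id t).sub_const 1).add (hdE t)).const_mul (a * ε / 2))
    refine this.congr_deriv ?_
    simp only [hq]
    field_simp
    ring
  have hebound : ∀ t ∈ Icc 0 T, (∀ s ∈ Icc 0 t, |q s| ≤ Q s) → |e t| ≤ K * ε ^ 2 * Ψ t * t := by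
    intro t ht hqs
    rcases ht.1.eq_or_lt with h | h
    · rw [← h, he0]; simp
    obtain ⟨c, hc, hce⟩ := exists_hasDerivAt_eq_slope e _ h
      (hec.mono (Icc_subset_Icc_right ht.2))
      (fun x hx => he' x ⟨hx.1, hx.2.trans_le ht.2⟩)
    have hpos : 0 < 1 - exp (-c) := by
      have : exp (-c) < 1 := exp_lt_one_iff.2 (by linarith [hc.1])
      linarith
    rw [he0, sub_zero, sub_zero, eq_div_iff h.ne'] at hce
    rw [← hce, abs_mul, abs_of_pos h, abs_div, abs_of_pos hpos]
    gcongr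
    rw [div_le_iff₀ hpos]
    calc |q c| ≤ Q c := hqs c ⟨hc.1.le, hc.2.le⟩
      _ = K * ε ^ 2 * Ψ c * (1 - exp (-c)) := by simp only [hQ]; ring
      _ ≤ _ := by gcongr; exact hΨmono hc.2.le
  have hesmall : ∀ t ∈ Icc 0 T, (∀ s ∈ Icc 0 t, |q s| ≤ Q s) →
      |e t| ≤ K * exp 32 * ε ^ 2 * t ∧ |e t| ≤ ε * t := by
    intro t ht hqs
    have h1 : |e t| ≤ K * exp 32 * ε ^ 2 * t := by
      refine (hebound t ht hqs).trans ?_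
      have := hΨ32 t
      have ht0 := ht.1
      calc K * ε ^ 2 * Ψ t * t ≤ K * ε ^ 2 * exp 32 * t := by gcongr
        _ = _ := by ring
    refine ⟨h1, h1.trans ?_⟩
    have ht0 := mul_nonneg hε.le ht.1
    calc K * exp 32 * ε ^ 2 * t = K * exp 32 * ε * (ε * t) := by ring
      _ ≤ 1 * (ε * t) := by gcongr
      _ = _ := one_mul _
  have hqQ : ∀ t ∈ Icc 0 T, |q t| ≤ Q t := by
    refine abs_le_of_abs_deriv_lt_of_forall_abs_le
      (q' := fun t => D t - exp (-t) - a * ε * (1 - exp (-t)) * exp (-t))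
      (Q' := fun t => K * ε ^ 2 * (exp (-t) * Ψ t + (1 - exp (-t)) * (4 * exp (-t / 8) * Ψ t)))
      hqc ?_ ?_ ?_ ?_
    · rw [hq0]; simp [hQ]
    · intro t ht
      have h1 := ((hdE t).const_sub 1)
      have := ((hP' t ht).sub h1.hasDerivWithinAt).sub
        ((h1.pow 2).const_mul (a * ε / 2)).hasDerivWithinAt
      refine this.congr_deriv ?_
      push_cast
      ring
    · intro t
      have := (((hdE t).const_sub 1).mul (hdΨ t)).const_mul (K * ε ^ 2)
      exact this.congr_deriv (by ring)
    · intro t ht hqs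
      have ht' : t ∈ Icc 0 T := ⟨ht.1, ht.2.le⟩
      have ht0 := ht.1
      have hes := (hesmall t ht' hqs).2
      have hv := abs_le.1 (abs_sub_le_of_abs_error_le ha hb hε ht.1 hes)
      have hw11 : w t ≤ 11 / 10 * t := by nlinarith
      have hεt : ε ^ 2 * t ≤ 1 / 2 := by
        refine le_trans ?_ hT
        gcongr
        exact ht.2.le
      have hmain := source_error_bound ha hb hε hεb ht.1 hεt hes
      rw [hD t ht hw11]
      refine hmain.trans_lt ?_
      rw [← hK]
      set E := exp (-t) with hE
      set F := exp (-t / 8) with hF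
      have hE0 : 0 < E := exp_pos _
      have hF0 : 0 < F := exp_pos _
      have hE1 : 0 ≤ 1 - E := by
        have : E ≤ 1 := exp_le_one_iff.2 (by linarith)
        linarith
      have hκ := barrier_deriv_gt ht.1 hE hF
      have hΨt := hΨ0 t
      have hpos : 0 < K * ε ^ 2 * (E * Ψ t) := by positivity
      have h1 : 2 * E * |e t| ≤ K * ε ^ 2 * Ψ t * (3 * ((1 - E) * F)) := by
        calc 2 * E * |e t| ≤ 2 * E * (K * ε ^ 2 * Ψ t * t) := by gcongr; exact hebound t ht' hqs
          _ = K * ε ^ 2 * Ψ t * (2 * E * t) := by ring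
          _ ≤ _ := by gcongr
      have h2 : K * ε ^ 2 * ((1 - E) * F) ≤ K * ε ^ 2 * Ψ t * ((1 - E) * F) := by
        have := hΨ1 t ht.1
        have h3 : 0 ≤ K * ε ^ 2 := by positivity
        have h4 : 0 ≤ K * ε ^ 2 * ((1 - E) * F) := by positivity
        nlinarith
      change 2 * E * |e t| + _ < _
      linarith
  intro t ht
  have hqs : ∀ s ∈ Icc 0 t, |q s| ≤ Q s := fun s hs => hqQ s ⟨hs.1, hs.2.trans ht.2⟩
  refine ⟨(hesmall t ht hqs).1, (hqQ t ht).trans ?_⟩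
  have h1 := exp_pos (-t)
  have h2 := hΨ32 t
  have h3 : (1 - exp (-t)) * Ψ t ≤ exp 32 := by nlinarith [hΨ0 t]
  calc Q t ≤ K * ε ^ 2 * exp 32 := by simp only [hQ]; gcongr
    _ = _ := by ring

theorem tG_nonneg {m : ℝ} (r : ℝ) : 0 ≤ tG m r := log_nonneg (by
  have : 0 ≤ r ^ 2 / m ^ 2 := by positivity
  linarith)

theorem tG_mono {m r s : ℝ} (hr : 0 ≤ r) (hrs : r ≤ s) : tG m r ≤ tG m s := by
  unfold tG
  gcongr

/-- The radius at which the logarithmic variable `tG m` takes the value `t`. -/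
def logRadius (m t : ℝ) : ℝ := m * √(exp t - 1)

theorem logRadius_tG {m r : ℝ} (hm : 0 < m) (hr : 0 ≤ r) : logRadius m (tG m r) = r := by
  have h : 0 ≤ r ^ 2 / m ^ 2 := by positivity
  rw [logRadius, tG, exp_log (by linarith), add_sub_cancel_left, ← div_pow,
    sqrt_sq (by positivity)]
  field_simp

theorem logRadius_nonneg {m : ℝ} (hm : 0 < m) (t : ℝ) : 0 ≤ logRadius m t := by
  unfold logRadius; positivity

theorem logRadius_pos {m t : ℝ} (hm : 0 < m) (ht : 0 < t) : 0 < logRadius m t := by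
  have : 0 < exp t - 1 := by linarith [add_one_lt_exp ht.ne']
  unfold logRadius; positivity

theorem logRadius_zero (m : ℝ) : logRadius m 0 = 0 := by simp [logRadius]

theorem logRadius_strictMono {m s t : ℝ} (hm : 0 < m) (hs : 0 ≤ s) (hst : s < t) :
    logRadius m s < logRadius m t := by
  have h1 : 0 ≤ exp s - 1 := by linarith [one_le_exp hs]
  have h2 : exp s < exp t := exp_lt_exp.2 hst
  unfold logRadius
  have := sqrt_lt_sqrt h1 (show exp s - 1 < exp t - 1 by linarith)
  gcongr

theorem logRadius_sq (m : ℝ) {t : ℝ} (ht : 0 ≤ t) :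
    logRadius m t ^ 2 = m ^ 2 * (exp t - 1) := by
  rw [logRadius, mul_pow, sq_sqrt (by linarith [one_le_exp ht])]

theorem tG_logRadius {m t : ℝ} (hm : 0 < m) (ht : 0 ≤ t) : tG m (logRadius m t) = t := by
  rw [tG, logRadius_sq m ht, mul_div_cancel_left₀ _ (by positivity), add_sub_cancel, log_exp]

theorem continuous_logRadius (m : ℝ) : Continuous (logRadius m) := by
  unfold logRadius; fun_prop

theorem hasDerivAt_logRadius {m t : ℝ} (ht : 0 < t) :
    HasDerivAt (logRadius m) (logRadius m t / (2 * (1 - exp (-t)))) t := by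
  have hpos : 0 < exp t - 1 := by linarith [add_one_lt_exp ht.ne']
  have h := (((hasDerivAt_exp t).sub_const 1).sqrt hpos.ne').const_mul m
  refine h.congr_deriv ?_
  have hs : √(exp t - 1) ≠ 0 := (sqrt_pos.2 hpos).ne'
  have h1 : 1 - exp (-t) = √(exp t - 1) ^ 2 / exp t := by
    rw [sq_sqrt hpos.le, exp_neg]
    field_simp
  rw [h1, logRadius]
  field_simp

section Radial

variable {g u : ℝ → ℝ} {beta gam : ℝ}

/-- The normalised flux `-r u'(r)` of a radial function on the closed unit disk. -/
def flux (u : ℝ → ℝ) (r : ℝ) : ℝ := -(r * derivWithin u (Icc 0 1) r)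

theorem IsGSol.continuousOn (hu : IsGSol g beta gam u) : ContinuousOn u (Icc 0 1) :=
  hu.1.continuousOn

theorem IsGSol.nonneg (hu : IsGSol g beta gam u) {r : ℝ} (hr : r ∈ Icc (0 : ℝ) 1) : 0 ≤ u r := by
  rcases hr.2.eq_or_lt with h | h
  · rw [h, hu.2.2.2.1]
  · exact (hu.2.2.1 r ⟨hr.1, h⟩).le

theorem IsGSol.continuousOn_comp (hu : IsGSol g beta gam u) (hg : ContinuousOn g (Ici 0)) :
    ContinuousOn (fun r => g (u r)) (Icc 0 1) :=
  hg.comp hu.continuousOn fun _ hr => hu.nonneg hr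

theorem IsGSol.continuousOn_flux (hu : IsGSol g beta gam u) : ContinuousOn (flux u) (Icc 0 1) :=
  (continuousOn_id.mul (hu.1.continuousOn_derivWithin (uniqueDiffOn_Icc one_pos)
    (by exact_mod_cast le_top))).neg

theorem IsGSol.hasDerivAt (hu : IsGSol g beta gam u) {r : ℝ} (hr : r ∈ Ioo (0 : ℝ) 1) :
    HasDerivAt u (derivWithin u (Icc 0 1) r) r := by
  have hn : Icc (0 : ℝ) 1 ∈ 𝓝 r := Icc_mem_nhds hr.1 hr.2
  rw [derivWithin_of_mem_nhds hn]
  exact ((hu.1.differentiableOn (by simp) r ⟨hr.1.le, hr.2.le⟩).differentiableAt hn).hasDerivAt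

theorem IsGSol.hasDerivAt_flux (hu : IsGSol g beta gam u) {r : ℝ} (hr : r ∈ Ioo (0 : ℝ) 1) :
    HasDerivAt (flux u) (r * (beta * u r * g (u r))) r := by
  have hC : ContDiffOn ℝ 1 (deriv u) (Ioo 0 1) :=
    ((contDiffOn_infty.1 hu.1 2).mono Ioo_subset_Icc_self).deriv_of_isOpen isOpen_Ioo
      one_add_one_eq_two.le
  have hd : HasDerivAt (deriv u) (deriv (deriv u) r) r :=
    ((hC.differentiableOn one_ne_zero r hr).differentiableAt (Ioo_mem_nhds hr.1 hr.2)).hasDerivAt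
  have heq : flux u =ᶠ[𝓝 r] fun s => -(s * deriv u s) := by
    filter_upwards [Ioo_mem_nhds hr.1 hr.2] with s hs
    rw [flux, derivWithin_of_mem_nhds (Icc_mem_nhds hs.1 hs.2)]
  refine (((hasDerivAt_id r).mul hd).neg.congr_of_eventuallyEq heq).congr_deriv ?_
  rw [← hu.2.1 r hr, radLap]
  have := hr.1.ne'
  simp only [id]
  field_simp
  ring

theorem IsGSol.integral_radLap (hu : IsGSol g beta gam u) (hg : ContinuousOn g (Ici 0)) {R : ℝ}
    (hR0 : 0 ≤ R) (hR1 : R ≤ 1) :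
    ∫ r in Ioo (0 : ℝ) R, radLap u r * (2 * π * r) = 2 * π * flux u R := by
  have hsub : Icc 0 R ⊆ Icc (0 : ℝ) 1 := Icc_subset_Icc_right hR1
  have h1 : ∫ r in Ioo (0 : ℝ) R, radLap u r * (2 * π * r)
      = ∫ r in Ioo (0 : ℝ) R, 2 * π * (r * (beta * u r * g (u r))) := by
    refine setIntegral_congr_fun measurableSet_Ioo fun r hr => ?_
    rw [hu.2.1 r ⟨hr.1, hr.2.trans_le hR1⟩]
    ring
  have hc : ContinuousOn (fun r => r * (beta * u r * g (u r))) (Icc 0 R) :=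
    (continuousOn_id.mul ((continuousOn_const.mul hu.continuousOn).mul
      (hu.continuousOn_comp hg))).mono hsub
  rw [h1, integral_const_mul, ← integral_Ioc_eq_integral_Ioo,
    ← intervalIntegral.integral_of_le hR0,
    intervalIntegral.integral_eq_sub_of_hasDerivAt_of_le hR0 (hu.continuousOn_flux.mono hsub)
      (fun x hx => hu.hasDerivAt_flux ⟨hx.1, hx.2.trans_le hR1⟩)
      (hc.intervalIntegrable_of_Icc hR0)]
  simp [flux]

theorem IsGSol.integrableOn_mul_radLap (hu : IsGSol g beta gam u) (hg : ContinuousOn g (Ici 0))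
    {f : ℝ → ℝ} (hf : ContinuousOn f (Icc 0 1)) {R : ℝ} (hR1 : R ≤ 1) :
    IntegrableOn (fun r => f r * radLap u r * (2 * π * r)) (Ioo 0 R) := by
  have hc : ContinuousOn (fun r => f r * (beta * u r * g (u r)) * (2 * π * r)) (Icc 0 1) :=
    (hf.mul ((continuousOn_const.mul hu.continuousOn).mul (hu.continuousOn_comp hg))).mul
      (continuousOn_const.mul continuousOn_id)
  refine ((hc.integrableOn_Icc).mono_set
    (Ioo_subset_Icc_self.trans (Icc_subset_Icc_right hR1))).congr_fun (fun r hr => ?_)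
    measurableSet_Ioo
  simp only []
  rw [hu.2.1 r ⟨hr.1, hr.2.trans_le hR1⟩]

/-- The rescaled source term in the logarithmic variable. -/
def logSource (g u : ℝ → ℝ) (gam m t : ℝ) : ℝ :=
  exp t * u (logRadius m t) * g (u (logRadius m t)) / (gam * g gam)

theorem IsGSol.hasDerivAt_flux_logRadius (hu : IsGSol g beta gam u) {m t : ℝ} (hm : 0 < m)
    (hgam : 0 < gam) (hggam : 0 < g gam)
    (hmu : m ^ 2 * beta * gam ^ 2 * g gam = 4) (ht : 0 < t) (ht1 : logRadius m t < 1) :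
    HasDerivAt (fun s => gam / 2 * flux u (logRadius m s)) (logSource g u gam m t) t := by
  have h := ((hu.hasDerivAt_flux ⟨logRadius_pos hm ht, ht1⟩).comp t
    (hasDerivAt_logRadius ht)).const_mul (gam / 2)
  refine h.congr_deriv ?_
  have hE : 0 < 1 - exp (-t) := by
    have : exp (-t) < 1 := exp_lt_one_iff.2 (by linarith)
    linarith
  have hsq : logRadius m t ^ 2 = m ^ 2 * exp t * (1 - exp (-t)) := by
    rw [logRadius_sq m ht.le, mul_sub (m ^ 2 * exp t), mul_assoc _ _ (exp (-t)), ← exp_add]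
    simp; ring
  rw [logSource]
  set R := logRadius m t
  set U := u R
  have hb : m ^ 2 * beta = 4 / (gam ^ 2 * g gam) := by
    field_simp; linarith
  calc gam / 2 * (R * (beta * U * g U) * (R / (2 * (1 - exp (-t)))))
      = gam / 4 * beta * U * g U * R ^ 2 / (1 - exp (-t)) := by field_simp; ring
    _ = gam / 4 * (m ^ 2 * beta) * U * g U * exp t := by rw [hsq]; field_simp
    _ = _ := by rw [hb]; field_simp

end Radial

/-- The constant in the error bounds of the expansion. -/
def expansionConst (a : ℝ) : ℝ := 40 * 32 ^ 4 * (a / 2 + 1) ^ 2 * exp 32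

theorem IsGSol.expansion_of_le_one {a c0 beta gam m R : ℝ} {g u : ℝ → ℝ} (hG : GCtx a c0 g)
    (hu : IsGSol g beta gam u) (hm : 0 < m) (hmu : m ^ 2 * beta * gam ^ 2 * g gam = 4)
    (hgb : 100 * (a / 2 + 1) ≤ gam) (hgK : expansionConst a ≤ gam) (hgc : 3 * c0 ≤ gam)
    (hR1 : R ≤ 1) (hRT : tG m R ≤ gam ^ 2 / 2) {r : ℝ} (hr : r ∈ Icc 0 R) :
    |gam * (gam - u r) - tG m r - a * gam⁻¹ / 2 * (tG m r - 1 + exp (-tG m r))|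
        ≤ expansionConst a * gam⁻¹ ^ 2 * tG m r ∧
      |gam / 2 * flux u r - (1 - exp (-tG m r)) - a * gam⁻¹ / 2 * (1 - exp (-tG m r)) ^ 2|
        ≤ expansionConst a * gam⁻¹ ^ 2 := by
  obtain ⟨ha, hc0, hg, hgpos, hgexp⟩ := hG
  have hR0 : 0 ≤ R := hr.1.trans hr.2
  have hgam : 0 < gam := by linarith
  have hgc' : c0 ≤ gam := by linarith
  have hggam : 0 < g gam := hgpos _ hgam.le
  set T := tG m R with hT
  have hmaps : ∀ t ∈ Icc 0 T, logRadius m t ∈ Icc (0 : ℝ) 1 := by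
    intro t ht
    refine ⟨logRadius_nonneg hm t, ?_⟩
    rcases ht.2.eq_or_lt with h | h
    · rw [h, hT, logRadius_tG hm hR0]; exact hR1
    · have := logRadius_strictMono hm ht.1 h
      rw [hT, logRadius_tG hm hR0] at this
      linarith
  have hlt : ∀ t ∈ Ico 0 T, logRadius m t < 1 := by
    intro t ht
    have := logRadius_strictMono hm ht.1 ht.2
    rw [hT, logRadius_tG hm hR0] at this
    linarith
  have huc : ContinuousOn (fun t => u (logRadius m t)) (Icc 0 T) :=
    hu.continuousOn.comp (continuous_logRadius m).continuousOn hmaps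
  have hPc : ContinuousOn (fun t => gam / 2 * flux u (logRadius m t)) (Icc 0 T) :=
    continuousOn_const.mul (hu.continuousOn_flux.comp (continuous_logRadius m).continuousOn hmaps)
  have hDc : ContinuousOn (logSource g u gam m) (Icc 0 T) :=
    (((continuous_exp.continuousOn).mul huc).mul
      ((hu.continuousOn_comp hg).comp (continuous_logRadius m).continuousOn hmaps)).div_const _
  have hw' : ∀ t ∈ Ioo 0 T, HasDerivAt (fun t => gam * (gam - u (logRadius m t)))
      (gam / 2 * flux u (logRadius m t) / (1 - exp (-t))) t := by
    intro t ht
    have h := (((hu.hasDerivAt ⟨logRadius_pos hm ht.1, hlt t ⟨ht.1.le, ht.2⟩⟩).comp t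
      (hasDerivAt_logRadius ht.1)).const_sub gam).const_mul gam
    refine h.congr_deriv ?_
    rw [flux]
    field_simp
  have hP' : ∀ t ∈ Ico 0 T, HasDerivWithinAt (fun t => gam / 2 * flux u (logRadius m t))
      (logSource g u gam m t) (Ici t) t := by
    intro t ht
    rcases ht.1.eq_or_lt with h | h
    · subst h
      have hder : ∀ s ∈ Ioo 0 T, HasDerivAt (fun t => gam / 2 * flux u (logRadius m t))
          (logSource g u gam m s) s := fun s hs =>
        hu.hasDerivAt_flux_logRadius hm hgam hggam hmu hs.1 (hlt s ⟨hs.1.le, hs.2⟩)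
      refine hasDerivWithinAt_Ici_of_tendsto_deriv (s := Ioo 0 T)
        (fun s hs => (hder s hs).differentiableAt.differentiableWithinAt)
        ((hPc 0 ⟨le_rfl, ht.2.le⟩).mono Ioo_subset_Icc_self) (Ioo_mem_nhdsGT ht.2) ?_
      have hlim : Tendsto (logSource g u gam m) (𝓝[>] 0) (𝓝 (logSource g u gam m 0)) := by
        rw [← nhdsWithin_Ioo_eq_nhdsGT ht.2]
        exact (hDc 0 ⟨le_rfl, ht.2.le⟩).mono_left (nhdsWithin_mono _ Ioo_subset_Icc_self)
      refine hlim.congr' ?_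
      filter_upwards [Ioo_mem_nhdsGT ht.2] with s hs
      exact (hder s hs).deriv.symm
    · exact (hu.hasDerivAt_flux_logRadius hm hgam hggam hmu h (hlt t ht)).hasDerivWithinAt
  have hD : ∀ t ∈ Ico 0 T, gam * (gam - u (logRadius m t)) ≤ 11 / 10 * t →
      logSource g u gam m t = (1 - gam⁻¹ ^ 2 * (gam * (gam - u (logRadius m t)))) *
        exp (t - 2 * (gam * (gam - u (logRadius m t)))
          + gam⁻¹ ^ 2 * (gam * (gam - u (logRadius m t))) ^ 2
          + a * gam⁻¹ * (gam * (gam - u (logRadius m t)))) := by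
    intro t ht hwt
    set U := u (logRadius m t) with hU
    have hUc : c0 ≤ U := by
      have h1 : gam * (gam - U) ≤ gam * (11 / 20 * gam) := by nlinarith [ht.2]
      have h2 := le_of_mul_le_mul_left h1 hgam
      linarith
    rw [logSource, ← hU, hgexp U hUc, hgexp gam hgc']
    have h1 : t - 2 * (gam * (gam - U)) + gam⁻¹ ^ 2 * (gam * (gam - U)) ^ 2
        + a * gam⁻¹ * (gam * (gam - U)) = t + (U ^ 2 - a * U) - (gam ^ 2 - a * gam) := by
      field_simp; ring
    rw [h1, exp_sub (t + _), exp_add t]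
    have h2 := (exp_pos (gam ^ 2 - a * gam)).ne'
    field_simp
    ring
  have hgam0 : 0 < gam⁻¹ := inv_pos.2 hgam
  have key := log_variable_expansion
    (w := fun t => gam * (gam - u (logRadius m t))) (K := 40 * 32 ^ 4 * (a / 2 + 1) ^ 2) ha rfl hgam0
    (by rw [← div_eq_mul_inv, div_le_one hgam]; exact hgb) rfl
    (by rw [← div_eq_mul_inv, div_le_one hgam]; exact hgK)
    (by rw [inv_pow, inv_mul_le_iff₀ (by positivity)]; linarith)
    (continuousOn_const.mul (continuousOn_const.sub huc)) hPc
    (by simp [logRadius_zero, hu.2.2.2.2]) (by simp [logRadius_zero, flux]) hw' hP' hD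
    (tG m r) ⟨tG_nonneg r, tG_mono hr.1 hr.2⟩
  simp only [logRadius_tG hm hr.1] at key
  exact key

theorem abs_mul_sub_le {a gam x t : ℝ} (ha : 0 < a) (hgb : 100 * (a / 2 + 1) ≤ gam)
    (hgK : expansionConst a ≤ gam) (ht : 0 ≤ t) (h : |gam * (gam - x) - t
      - a * gam⁻¹ / 2 * (t - 1 + exp (-t))| ≤ expansionConst a * gam⁻¹ ^ 2 * t) :
    |gam * (gam - x) - t| ≤ t / 100 := by
  have hgam : 0 < gam := by linarith
  have h1 := abs_sub_le_of_abs_error_le ha rfl (inv_pos.2 hgam) ht (h.trans (by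
    calc expansionConst a * gam⁻¹ ^ 2 * t ≤ gam * gam⁻¹ ^ 2 * t := by gcongr
      _ = gam⁻¹ * t := by field_simp))
  refine h1.trans ?_
  calc (a / 2 + 1) * (gam⁻¹ * t) = (100 * (a / 2 + 1)) * gam⁻¹ * t / 100 := by ring
    _ ≤ gam * gam⁻¹ * t / 100 := by gcongr
    _ = _ := by field_simp

/-- For large central values the expansion region is contained in the unit disk. -/
theorem IsGSol.radius_le_one {a c0 beta gam m R : ℝ} {g u : ℝ → ℝ} (hG : GCtx a c0 g)
    (hu : IsGSol g beta gam u) (hm : 0 < m) (hmu : m ^ 2 * beta * gam ^ 2 * g gam = 4)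
    (hgb : 100 * (a / 2 + 1) ≤ gam) (hgK : expansionConst a ≤ gam) (hgc : 3 * c0 ≤ gam)
    (hR : tG m R = gam ^ 2 / 2) : R ≤ 1 := by
  by_contra! hR1
  have ha := hG.1
  have hgam : 0 < gam := by linarith
  have hT : tG m 1 ≤ gam ^ 2 / 2 := hR ▸ tG_mono zero_le_one hR1.le
  have h := (hu.expansion_of_le_one hG hm hmu hgb hgK hgc le_rfl hT ⟨zero_le_one, le_rfl⟩).1
  rw [hu.2.2.2.1] at h
  have h1 := (abs_le.1 (abs_mul_sub_le ha hgb hgK (tG_nonneg _) h)).2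
  nlinarith

theorem exp_neg_le_inv {x : ℝ} (hx : 0 < x) : exp (-x) ≤ x⁻¹ := by
  rw [exp_neg]
  exact inv_anti₀ hx (by linarith [add_one_le_exp x])

theorem sG_eq (m r : ℝ) : sG m r = -(tG m r - 1 + exp (-tG m r)) / 2 := by
  have h : 0 < 1 + r ^ 2 / m ^ 2 := by positivity
  have h1 : exp (-tG m r) = (1 + r ^ 2 / m ^ 2)⁻¹ := by rw [tG, exp_neg, exp_log h]
  rw [sG, h1]
  field_simp
  ring

theorem IsGSol.mul_sub_bounds {a c0 beta gam m R : ℝ} {g u : ℝ → ℝ} (hG : GCtx a c0 g)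
    (hu : IsGSol g beta gam u) (hm : 0 < m) (hmu : m ^ 2 * beta * gam ^ 2 * g gam = 4)
    (hgb : 100 * (a / 2 + 1) ≤ gam) (hgK : expansionConst a ≤ gam) (hgc : 3 * c0 ≤ gam)
    (hR1 : R ≤ 1) (hRT : tG m R ≤ gam ^ 2 / 2) {r : ℝ} (hr : r ∈ Icc 0 R) :
    0 ≤ gam * (gam - u r) ∧ gam * (gam - u r) ≤ 2 * tG m r := by
  have h := abs_le.1 (abs_mul_sub_le hG.1 hgb hgK (tG_nonneg (m := m) r)
    (hu.expansion_of_le_one hG hm hmu hgb hgK hgc hR1 hRT hr).1)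
  have := tG_nonneg (m := m) r
  exact ⟨by linarith, by linarith⟩

/-- Two-sided bound for the energy `∫ u Δu` over the expansion region. -/
theorem IsGSol.integral_mul_radLap_bounds {a c0 beta gam m R : ℝ} {g u : ℝ → ℝ}
    (hG : GCtx a c0 g) (hu : IsGSol g beta gam u) (hbeta : 0 < beta) (hm : 0 < m)
    (hmu : m ^ 2 * beta * gam ^ 2 * g gam = 4)
    (hgb : 100 * (a / 2 + 1) ≤ gam) (hgK : expansionConst a ≤ gam) (hgc : 3 * c0 ≤ gam)
    (hR0 : 0 < R) (hR : tG m R = gam ^ 2 / 2) :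
    4 * π * ((1 - 2 * gam⁻¹) * (1 - gam⁻¹ - expansionConst a * gam⁻¹ ^ 2))
        ≤ ∫ r in Ioo (0 : ℝ) R, u r * radLap u r * (2 * π * r) ∧
      ∫ r in Ioo (0 : ℝ) R, u r * radLap u r * (2 * π * r)
        ≤ 4 * π * (1 + a * gam⁻¹ / 2 + expansionConst a * gam⁻¹ ^ 2) := by
  have ha := hG.1
  have hg := hG.2.2.1
  have hgam : 100 ≤ gam := by linarith
  have hgam0 : 0 < gam := by linarith
  have hR1 := hu.radius_le_one hG hm hmu hgb hgK hgc hR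
  have hexpand := fun {r : ℝ} (hr : r ∈ Icc 0 R) =>
    (hu.expansion_of_le_one hG hm hmu hgb hgK hgc hR1 hR.le hr).2
  have hbd := fun {r : ℝ} (hr : r ∈ Icc 0 R) =>
    hu.mul_sub_bounds hG hm hmu hgb hgK hgc hR1 hR.le hr
  have hlap : ∀ r ∈ Ioo (0 : ℝ) R, 0 ≤ radLap u r * (2 * π * r) := by
    intro r hr
    have hr1 : r < 1 := hr.2.trans_le hR1
    have hr0 := hr.1
    have h1 := hu.2.2.1 r ⟨hr.1.le, hr1⟩
    have h2 := hG.2.2.2.1 (u r) h1.le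
    rw [hu.2.1 r ⟨hr.1, hr1⟩]
    positivity
  have hint := hu.integrableOn_mul_radLap hg hu.continuousOn hR1
  have hintc : ∀ c S : ℝ, S ≤ 1 →
      IntegrableOn (fun r => c * radLap u r * (2 * π * r)) (Ioo 0 S) := fun c S hS =>
    hu.integrableOn_mul_radLap hg continuousOn_const hS
  have hconst : ∀ c S : ℝ, 0 ≤ S → S ≤ 1 →
      ∫ r in Ioo (0 : ℝ) S, c * radLap u r * (2 * π * r) = 2 * π * c * flux u S := by
    intro c S h0 h1
    simp_rw [mul_assoc c]
    rw [integral_const_mul, hu.integral_radLap hg h0 h1]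
    ring
  constructor
  · set S := logRadius m gam with hS
    have hS0 : 0 ≤ S := logRadius_nonneg hm gam
    have htS : tG m S = gam := tG_logRadius hm hgam0.le
    have hSR : S ≤ R := by
      rw [← logRadius_tG hm hR0.le, hR, hS]
      exact (logRadius_strictMono hm hgam0.le (by nlinarith)).le
    have hS1 : S ≤ 1 := hSR.trans hR1
    have h1 : ∫ r in Ioo (0 : ℝ) S, u r * radLap u r * (2 * π * r)
        ≤ ∫ r in Ioo (0 : ℝ) R, u r * radLap u r * (2 * π * r) := by
      refine setIntegral_mono_set hint ?_ (Ioo_subset_Ioo_right hSR).eventuallyLE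
      refine (ae_restrict_iff' measurableSet_Ioo).2 (Eventually.of_forall fun r hr => ?_)
      have h2 := (hu.2.2.1 r ⟨hr.1.le, hr.2.trans_le hR1⟩).le
      change 0 ≤ u r * radLap u r * (2 * π * r)
      rw [mul_assoc]
      exact mul_nonneg h2 (hlap r hr)
    have h2 : ∫ r in Ioo (0 : ℝ) S, (gam - 2) * radLap u r * (2 * π * r)
        ≤ ∫ r in Ioo (0 : ℝ) S, u r * radLap u r * (2 * π * r) := by
      refine setIntegral_mono_on (hintc _ _ hS1)
        (hint.mono_set (Ioo_subset_Ioo_right hSR)) measurableSet_Ioo fun r hr => ?_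
      have hrR : r < R := hr.2.trans_le hSR
      have h3 := (hbd ⟨hr.1.le, hrR.le⟩).2
      have h4 : tG m r ≤ gam := htS ▸ tG_mono hr.1.le hr.2.le
      have h5 : gam * (gam - u r) ≤ gam * 2 := by linarith
      have h6 := le_of_mul_le_mul_left h5 hgam0
      rw [mul_assoc (gam - 2), mul_assoc (u r)]
      exact mul_le_mul_of_nonneg_right (by linarith) (hlap r ⟨hr.1, hrR⟩)
    rw [hconst _ _ hS0 hS1] at h2
    refine le_trans ?_ (h2.trans h1)
    have h3 := (abs_le.1 (hexpand ⟨hS0, hSR⟩)).1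
    rw [htS] at h3
    have h4 := exp_neg_le_inv hgam0
    have h5 : 0 ≤ a * gam⁻¹ / 2 * (1 - exp (-gam)) ^ 2 := by positivity
    have h6 : 0 ≤ 1 - 2 * gam⁻¹ := by
      have : gam⁻¹ ≤ 100⁻¹ := inv_anti₀ (by norm_num) hgam
      norm_num at this ⊢
      linarith
    calc 4 * π * ((1 - 2 * gam⁻¹) * (1 - gam⁻¹ - expansionConst a * gam⁻¹ ^ 2))
        ≤ 4 * π * ((1 - 2 * gam⁻¹) * (gam / 2 * flux u S)) := by gcongr; linarith
      _ = 2 * π * (gam - 2) * flux u S := by field_simp; ring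
  · have h1 : ∫ r in Ioo (0 : ℝ) R, u r * radLap u r * (2 * π * r)
        ≤ ∫ r in Ioo (0 : ℝ) R, gam * radLap u r * (2 * π * r) := by
      refine setIntegral_mono_on hint (hintc _ _ hR1) measurableSet_Ioo fun r hr => ?_
      have h3 := (hbd ⟨hr.1.le, hr.2.le⟩).1
      have h4 := nonneg_of_mul_nonneg_right h3 hgam0
      rw [mul_assoc gam, mul_assoc (u r)]
      exact mul_le_mul_of_nonneg_right (by linarith) (hlap r hr)
    rw [hconst _ _ hR0.le hR1] at h1
    refine h1.trans ?_
    have h3 := (abs_le.1 (hexpand ⟨hR0.le, le_rfl⟩)).2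
    set E := exp (-tG m R) with hE
    have hE0 : 0 < E := exp_pos _
    have hE1 : E ≤ 1 := exp_le_one_iff.2 (by linarith [tG_nonneg (m := m) R])
    have h4 : a * gam⁻¹ / 2 * (1 - E) ^ 2 ≤ a * gam⁻¹ / 2 :=
      mul_le_of_le_one_right (by positivity) (by nlinarith)
    calc 2 * π * gam * flux u R = 4 * π * (gam / 2 * flux u R) := by ring
      _ ≤ _ := by gcongr; linarith

theorem IsGSol.abs_integral_radLap_sub_le {a c0 beta gam m R : ℝ} {g u : ℝ → ℝ}
    (hG : GCtx a c0 g) (hu : IsGSol g beta gam u) (hm : 0 < m)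
    (hmu : m ^ 2 * beta * gam ^ 2 * g gam = 4)
    (hgb : 100 * (a / 2 + 1) ≤ gam) (hgK : expansionConst a ≤ gam) (hgc : 3 * c0 ≤ gam)
    (hR0 : 0 < R) (hR : tG m R = gam ^ 2 / 2) :
    |(∫ r in Ioo (0 : ℝ) R, radLap u r * (2 * π * r)) - (4 * π / gam + 2 * π * a / gam ^ 2)|
      ≤ 4 * π * (expansionConst a + 4) / gam ^ 3 := by
  have ha := hG.1
  have hgam0 : 0 < gam := by linarith
  have hR1 := hu.radius_le_one hG hm hmu hgb hgK hgc hR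
  have h := (hu.expansion_of_le_one hG hm hmu hgb hgK hgc hR1 hR.le ⟨hR0.le, le_rfl⟩).2
  rw [hR] at h
  rw [hu.integral_radLap hG.2.2.1 hR0.le hR1]
  have hE2 := exp_neg_le_inv (show 0 < gam ^ 2 / 2 by positivity)
  set E := exp (-(gam ^ 2 / 2)) with hE
  have hE0 : 0 < E := exp_pos _
  have hE1 : E ≤ 1 := exp_le_one_iff.2 (by linarith [sq_nonneg gam])
  have hE3 : E ≤ 2 * gam⁻¹ ^ 2 := hE2.trans_eq (by field_simp)
  have hag : a * gam⁻¹ ≤ 1 := by rw [← div_eq_mul_inv, div_le_one hgam0]; linarith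
  have hag0 : 0 ≤ a * gam⁻¹ := by positivity
  have h' := abs_le.1 h
  have hEE : 0 ≤ 1 - (1 - E) ^ 2 ∧ 1 - (1 - E) ^ 2 ≤ 2 * E := ⟨by nlinarith, by nlinarith⟩
  have h1 : 0 ≤ a * gam⁻¹ * (1 - (1 - E) ^ 2) := mul_nonneg hag0 hEE.1
  have h2 : a * gam⁻¹ * (1 - (1 - E) ^ 2) ≤ 2 * E :=
    (mul_le_of_le_one_left hEE.1 hag).trans hEE.2
  have h3 : |gam / 2 * flux u R - (1 + a * gam⁻¹ / 2)|
      ≤ (expansionConst a + 4) * gam⁻¹ ^ 2 :=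
    abs_le.2 ⟨by linarith, by linarith⟩
  have h4 : 2 * π * flux u R - (4 * π / gam + 2 * π * a / gam ^ 2)
      = 4 * π * gam⁻¹ * (gam / 2 * flux u R - (1 + a * gam⁻¹ / 2)) := by
    field_simp; ring
  rw [h4, abs_mul, abs_of_pos (by positivity)]
  calc _ ≤ 4 * π * gam⁻¹ * ((expansionConst a + 4) * gam⁻¹ ^ 2) := by gcongr
    _ = _ := by field_simp

theorem IsGSol.abs_sub_expansion_le {a c0 beta gam m R : ℝ} {g u : ℝ → ℝ}
    (hG : GCtx a c0 g) (hu : IsGSol g beta gam u) (hm : 0 < m)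
    (hmu : m ^ 2 * beta * gam ^ 2 * g gam = 4)
    (hgb : 100 * (a / 2 + 1) ≤ gam) (hgK : expansionConst a ≤ gam) (hgc : 3 * c0 ≤ gam)
    (hR : tG m R = gam ^ 2 / 2) {r : ℝ} (hr : r ∈ Icc 0 R) :
    |u r - (gam - tG m r / gam + a * sG m r / gam ^ 2)|
      ≤ expansionConst a * tG m r / gam ^ 3 := by
  have ha := hG.1
  have hgam0 : 0 < gam := by linarith
  have hR1 := hu.radius_le_one hG hm hmu hgb hgK hgc hR
  have h := (hu.expansion_of_le_one hG hm hmu hgb hgK hgc hR1 hR.le hr).1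
  have h4 : u r - (gam - tG m r / gam + a * sG m r / gam ^ 2)
      = -(gam⁻¹ * (gam * (gam - u r) - tG m r
        - a * gam⁻¹ / 2 * (tG m r - 1 + exp (-tG m r)))) := by
    rw [sG_eq]
    field_simp; ring
  rw [h4, abs_neg, abs_mul, abs_of_pos (inv_pos.2 hgam0)]
  calc _ ≤ gam⁻¹ * (expansionConst a * gam⁻¹ ^ 2 * tG m r) := by gcongr
    _ = _ := by field_simp

/-- As γ → +∞:
(i) |u_γ(r) − (γ − t_γ(r)/γ + aS_γ(r)/γ²)| ≤ C t_γ(r)/γ³ on [0,ρ_γ] for large γ;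
(ii) ∫_{B₀(ρ_γ)} Δu_γ dy = 4π/γ + 2πa/γ² + O(γ⁻³);
(iii) ∫_{B₀(ρ_γ)} u_γ Δu_γ dy = 4π + o(1);
where μ_γ² β_γ γ² g(γ) = 4 and t_γ(ρ_γ) = γ²/2. -/
theorem statement15 (a c0 : ℝ) (g : ℝ → ℝ) (hG : GCtx a c0 g)
    (β : ℝ → ℝ) (u : ℝ → ℝ → ℝ)
    (hsol : ∀ γ : ℝ, 0 < γ → 0 < β γ ∧ IsGSol g (β γ) γ (u γ))
    (μ : ℝ → ℝ)
    (hμ : ∀ γ : ℝ, 0 < γ → 0 < μ γ ∧ (μ γ) ^ 2 * β γ * γ ^ 2 * g γ = 4)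
    (ρ : ℝ → ℝ)
    (hρ : ∀ γ : ℝ, 0 < γ → 0 < ρ γ ∧ tG (μ γ) (ρ γ) = γ ^ 2 / 2) :
    (∃ C : ℝ, 0 < C ∧ ∃ γ0 : ℝ, ∀ γ : ℝ, γ0 ≤ γ → ∀ r ∈ Set.Icc (0:ℝ) (ρ γ),
      |u γ r - (γ - tG (μ γ) r / γ + a * sG (μ γ) r / γ ^ 2)|
        ≤ C * tG (μ γ) r / γ ^ 3) ∧
    (∃ C : ℝ, ∀ᶠ γ in atTop,
      |(∫ r in Set.Ioo (0:ℝ) (ρ γ), radLap (u γ) r * (2 * π * r))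
        - (4 * π / γ + 2 * π * a / γ ^ 2)| ≤ C / γ ^ 3) ∧
    Tendsto (fun γ : ℝ => ∫ r in Set.Ioo (0:ℝ) (ρ γ), u γ r * radLap (u γ) r * (2 * π * r))
      atTop (𝓝 (4 * π)) := by
  have ha := hG.1
  set G := max (100 * (a / 2 + 1)) (max (expansionConst a) (3 * c0)) with hGdef
  have hlarge : ∀ γ, G ≤ γ →
      0 < γ ∧ 100 * (a / 2 + 1) ≤ γ ∧ expansionConst a ≤ γ ∧ 3 * c0 ≤ γ := by
    intro γ hγ
    obtain ⟨h1, h2⟩ := max_le_iff.1 hγ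
    obtain ⟨h2, h3⟩ := max_le_iff.1 h2
    exact ⟨by linarith, h1, h2, h3⟩
  refine ⟨⟨expansionConst a, by unfold expansionConst; positivity, G, fun γ hγ r hr => ?_⟩,
    ⟨4 * π * (expansionConst a + 4), ?_⟩, ?_⟩
  · obtain ⟨h0, h1, h2, h3⟩ := hlarge γ hγ
    exact (hsol γ h0).2.abs_sub_expansion_le hG (hμ γ h0).1 (hμ γ h0).2 h1 h2 h3 (hρ γ h0).2 hr
  · filter_upwards [eventually_ge_atTop G] with γ hγ
    obtain ⟨h0, h1, h2, h3⟩ := hlarge γ hγ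
    exact (hsol γ h0).2.abs_integral_radLap_sub_le hG (hμ γ h0).1 (hμ γ h0).2 h1 h2 h3
      (hρ γ h0).1 (hρ γ h0).2
  · have hinv : Tendsto (fun γ : ℝ => γ⁻¹) atTop (𝓝 0) := tendsto_inv_atTop_zero
    have hbounds : ∀ᶠ γ in atTop, _ := (eventually_ge_atTop G).mono fun γ hγ =>
      have ⟨h0, h1, h2, h3⟩ := hlarge γ hγ
      (hsol γ h0).2.integral_mul_radLap_bounds hG (hsol γ h0).1 (hμ γ h0).1 (hμ γ h0).2 h1 h2 h3
        (hρ γ h0).1 (hρ γ h0).2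
    refine tendsto_of_tendsto_of_tendsto_of_le_of_le' ?_ ?_
      (hbounds.mono fun _ h => h.1) (hbounds.mono fun _ h => h.2)
    · have hc : Continuous fun x : ℝ =>
          4 * π * ((1 - 2 * x) * (1 - x - expansionConst a * x ^ 2)) := by fun_prop
      simpa [Function.comp_def] using (hc.tendsto 0).comp hinv
    · have hc : Continuous fun x : ℝ =>
          4 * π * (1 + a * x / 2 + expansionConst a * x ^ 2) := by fun_prop
      simpa [Function.comp_def] using (hc.tendsto 0).comp hinv

end
end

section
/- Fix c₁ > max(c₀, a/2), and for γ > c₁ let r_γ ∈ (0,1) be the unique radius with u_γ(r_γ) = c₁. Then, as γ → +∞: u_γ(r) = γ − (t_γ(r)/γ)(1 + a/(2γ)) + o(t_γ(r)/γ²) uniformly for r ∈ [ρ_γ, r_γ]; and there exists δ > 0 such that ∫_{B₀(r_γ) \ B₀(ρ_γ)} Δu_γ dy = O(exp(−δγ)). -/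
open Real Set Filter MeasureTheory Topology

noncomputable section

theorem monotoneOn_Icc_of_hasDerivAt {f f' : ℝ → ℝ} {a b : ℝ}
    (hc : ContinuousOn f (Icc a b)) (hd : ∀ x ∈ Ioo a b, HasDerivAt f (f' x) x)
    (hf : ∀ x ∈ Ioo a b, 0 ≤ f' x) : MonotoneOn f (Icc a b) := by
  refine monotoneOn_of_deriv_nonneg (convex_Icc a b) hc ?_ ?_ <;> rw [interior_Icc]
  · exact fun x hx => (hd x hx).differentiableAt.differentiableWithinAt
  · exact fun x hx => (hd x hx).deriv ▸ hf x hx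

/-- A radial solution `u` on `[0, R]` with values at least `c1`, together with its flux
`F r = -r u'(r)`, written as a first order system. -/
structure RadialProfile (a c1 β γ μ R : ℝ) (u F : ℝ → ℝ) : Prop where
  c1_pos : 0 < c1
  half_lt : a / 2 < c1
  c1_lt : c1 < γ
  one_le : 1 ≤ 2 * γ * c1
  β_pos : 0 < β
  μ_pos : 0 < μ
  R_pos : 0 < R
  scale : μ ^ 2 * β * γ ^ 2 * exp (γ ^ 2 - a * γ) = 4
  u_cont : ContinuousOn u (Icc 0 R)
  F_cont : ContinuousOn F (Icc 0 R)
  u_zero : u 0 = γ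
  F_zero : F 0 = 0
  le_u : ∀ r ∈ Icc 0 R, c1 ≤ u r
  hasDerivAt_u : ∀ r ∈ Ioo 0 R, HasDerivAt u (-(F r / r)) r
  hasDerivAt_F : ∀ r ∈ Ioo 0 R, HasDerivAt F (r * (β * u r * exp (u r ^ 2 - a * u r))) r

/-- Half of the logarithmic derivative of `t exp (t² - a t)` at `γ`. -/
def halfSlope (a γ : ℝ) : ℝ := γ - a / 2 + 1 / (2 * γ)

/-- The rescaled logarithm `log (1 + (M / γ) r² / μ²)` with `M = halfSlope a γ`. -/
def bubbleLog (a γ μ r : ℝ) : ℝ := log (1 + halfSlope a γ / γ * (r ^ 2 / μ ^ 2))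

namespace RadialProfile

variable {a c1 β γ μ R : ℝ} {u F : ℝ → ℝ}

theorem γ_pos (h : RadialProfile a c1 β γ μ R u F) : 0 < γ := h.c1_pos.trans h.c1_lt

theorem halfSlope_pos (h : RadialProfile a c1 β γ μ R u F) : 0 < halfSlope a γ := by
  have h1 := h.half_lt
  have h2 := h.c1_lt
  have : 0 < 1 / (2 * γ) := by have := h.γ_pos; positivity
  unfold halfSlope
  linarith

theorem arg_pos (h : RadialProfile a c1 β γ μ R u F) (r : ℝ) :
    0 < 1 + halfSlope a γ / γ * (r ^ 2 / μ ^ 2) := by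
  have := h.γ_pos
  have := h.halfSlope_pos
  positivity

theorem exp_bubbleLog (h : RadialProfile a c1 β γ μ R u F) (r : ℝ) :
    exp (bubbleLog a γ μ r) = 1 + halfSlope a γ / γ * (r ^ 2 / μ ^ 2) :=
  Real.exp_log (h.arg_pos r)

theorem bubbleLog_zero : bubbleLog a γ μ 0 = 0 := by simp [bubbleLog]

theorem bubbleLog_nonneg (h : RadialProfile a c1 β γ μ R u F) (r : ℝ) :
    0 ≤ bubbleLog a γ μ r := by
  apply Real.log_nonneg
  have := h.γ_pos
  have := h.halfSlope_pos
  have : 0 ≤ halfSlope a γ / γ * (r ^ 2 / μ ^ 2) := by positivity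
  linarith

theorem hasDerivAt_bubbleLog (h : RadialProfile a c1 β γ μ R u F) (r : ℝ) :
    HasDerivAt (bubbleLog a γ μ)
      (2 * halfSlope a γ * r / (γ * μ ^ 2 + halfSlope a γ * r ^ 2)) r := by
  have hγ := h.γ_pos
  have hM := h.halfSlope_pos
  have hμ := h.μ_pos
  have h1 : HasDerivAt (fun r : ℝ => 1 + halfSlope a γ / γ * (r ^ 2 / μ ^ 2))
      (halfSlope a γ / γ * (2 * r / μ ^ 2)) r := by
    have := (((hasDerivAt_pow 2 r).div_const (μ ^ 2)).const_mul (halfSlope a γ / γ)).const_add 1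
    simpa using this
  refine (h1.log (h.arg_pos r).ne').congr_deriv ?_
  field_simp

theorem continuous_bubbleLog (h : RadialProfile a c1 β γ μ R u F) :
    Continuous (bubbleLog a γ μ) :=
  continuous_iff_continuousAt.2 fun r => (h.hasDerivAt_bubbleLog r).continuousAt

theorem u_pos (h : RadialProfile a c1 β γ μ R u F) {r : ℝ} (hr : r ∈ Icc 0 R) : 0 < u r :=
  h.c1_pos.trans_le (h.le_u r hr)

theorem F_deriv_pos (h : RadialProfile a c1 β γ μ R u F) {r : ℝ} (hr : r ∈ Ioo 0 R) :
    0 < r * (β * u r * exp (u r ^ 2 - a * u r)) := by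
  have := h.u_pos (Ioo_subset_Icc_self hr)
  have := h.β_pos
  have := hr.1
  positivity

theorem F_strictMono (h : RadialProfile a c1 β γ μ R u F) : StrictMonoOn F (Icc 0 R) := by
  refine strictMonoOn_of_deriv_pos (convex_Icc 0 R) h.F_cont ?_
  rw [interior_Icc]
  exact fun r hr => (h.hasDerivAt_F r hr).deriv ▸ h.F_deriv_pos hr

theorem F_pos (h : RadialProfile a c1 β γ μ R u F) {r : ℝ} (hr : r ∈ Ioc 0 R) : 0 < F r := by
  have := h.F_strictMono ⟨le_rfl, h.R_pos.le⟩ ⟨hr.1.le, hr.2⟩ hr.1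
  rwa [h.F_zero] at this

theorem u_le (h : RadialProfile a c1 β γ μ R u F) {r : ℝ} (hr : r ∈ Icc 0 R) : u r ≤ γ := by
  have : MonotoneOn (fun r => -u r) (Icc 0 R) := by
    refine monotoneOn_Icc_of_hasDerivAt h.u_cont.neg
      (fun r hr => (h.hasDerivAt_u r hr).neg) fun r hr => ?_
    have := h.F_pos ⟨hr.1, hr.2.le⟩
    have := hr.1
    rw [neg_neg]
    positivity
  have := this ⟨le_rfl, h.R_pos.le⟩ hr hr.1
  simp only [h.u_zero] at this
  linarith

theorem hasDerivAt_energy (h : RadialProfile a c1 β γ μ R u F) {r : ℝ} (hr : r ∈ Ioo 0 R) :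
    HasDerivAt (fun r => r ^ 2 * (β * u r * exp (u r ^ 2 - a * u r)))
      (r * (β * u r * exp (u r ^ 2 - a * u r)) *
        (2 - (2 * u r - a + 1 / u r) * F r)) r := by
  have hu := h.hasDerivAt_u r hr
  have hr0 := hr.1.ne'
  have hu0 := (h.u_pos (Ioo_subset_Icc_self hr)).ne'
  have h1 := (hasDerivAt_pow 2 r).mul ((hu.const_mul β).mul ((hu.pow 2).sub (hu.const_mul a)).exp)
  refine h1.congr_deriv ?_
  simp
  field_simp
  ring

theorem continuousOn_energy (h : RadialProfile a c1 β γ μ R u F) :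
    ContinuousOn (fun r => r ^ 2 * (β * u r * exp (u r ^ 2 - a * u r))) (Icc 0 R) := by
  have := h.u_cont
  fun_prop

theorem energy_le (h : RadialProfile a c1 β γ μ R u F) {r : ℝ} (hr : r ∈ Icc 0 R) :
    r ^ 2 * (β * u r * exp (u r ^ 2 - a * u r)) ≤ 2 * F r := by
  have hmono : MonotoneOn
      (fun r => 2 * F r - r ^ 2 * (β * u r * exp (u r ^ 2 - a * u r))) (Icc 0 R) := by
    refine monotoneOn_Icc_of_hasDerivAt ((h.F_cont.const_mul 2).sub h.continuousOn_energy)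
      (fun r hr => ((h.hasDerivAt_F r hr).const_mul 2).sub (h.hasDerivAt_energy hr))
      fun r hr => ?_
    have h1 := h.F_deriv_pos hr
    have h2 := h.F_pos ⟨hr.1, hr.2.le⟩
    have h3 : 0 ≤ 2 * u r - a + 1 / u r := by
      have := h.le_u r (Ioo_subset_Icc_self hr)
      have := h.half_lt
      have := h.u_pos (Ioo_subset_Icc_self hr)
      have : 0 < 1 / u r := by positivity
      linarith
    have := mul_nonneg h1.le (mul_nonneg h3 h2.le)
    linarith
  have := hmono ⟨le_rfl, h.R_pos.le⟩ hr hr.1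
  simp only [h.F_zero] at this
  linarith

theorem le_energy (h : RadialProfile a c1 β γ μ R u F) {r : ℝ} (hr : r ∈ Icc 0 R) :
    2 * F r - halfSlope a γ * F r ^ 2 ≤ r ^ 2 * (β * u r * exp (u r ^ 2 - a * u r)) := by
  have hmono : MonotoneOn (fun r => r ^ 2 * (β * u r * exp (u r ^ 2 - a * u r)) -
      (2 * F r - halfSlope a γ * F r ^ 2)) (Icc 0 R) := by
    have hc := h.F_cont
    refine monotoneOn_Icc_of_hasDerivAt (h.continuousOn_energy.sub (by fun_prop))
      (fun r hr => (h.hasDerivAt_energy hr).sub (((h.hasDerivAt_F r hr).const_mul 2).sub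
        (((h.hasDerivAt_F r hr).pow 2).const_mul (halfSlope a γ))))
      fun r hr => ?_
    have h1 := h.F_deriv_pos hr
    have h2 := h.F_pos ⟨hr.1, hr.2.le⟩
    have hu := h.u_pos (Ioo_subset_Icc_self hr)
    have hγ := h.γ_pos
    have h3 : 0 ≤ 2 * halfSlope a γ - (2 * u r - a + 1 / u r) := by
      have h4 := h.u_le (Ioo_subset_Icc_self hr)
      have h5 := h.le_u r (Ioo_subset_Icc_self hr)
      have h6 : 1 ≤ 2 * γ * u r := h.one_le.trans (by gcongr)
      have : 2 * halfSlope a γ - (2 * u r - a + 1 / u r) =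
          (γ - u r) * (2 * γ * u r - 1) / (γ * u r) := by
        unfold halfSlope
        field_simp
        ring
      rw [this]
      exact div_nonneg (mul_nonneg (by linarith) (by linarith)) (by positivity)
    have := mul_nonneg h1.le (mul_nonneg h3 h2.le)
    simp only [Nat.cast_ofNat, Nat.add_one_sub_one, pow_one]
    linarith
  have := hmono ⟨le_rfl, h.R_pos.le⟩ hr hr.1
  simp only [h.F_zero] at this
  linarith

theorem le_F (h : RadialProfile a c1 β γ μ R u F) {r : ℝ} (hr : r ∈ Ioc 0 R) :
    2 * r ^ 2 / (γ * μ ^ 2 + halfSlope a γ * r ^ 2) ≤ F r := by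
  have hγ := h.γ_pos
  have hμ := h.μ_pos
  have hM := h.halfSlope_pos
  have hβ := h.β_pos
  have hF := h.F_pos hr
  have key : ∀ s ∈ Ioo 0 r, r ^ 2 / F r - halfSlope a γ / 2 * r ^ 2 ≤
      2 / (β * u s * exp (u s ^ 2 - a * u s)) := by
    intro s hs
    have hsub : Icc s r ⊆ Icc 0 R := Icc_subset_Icc hs.1.le hr.2
    have hsR : s ∈ Ioc 0 R := ⟨hs.1, hs.2.le.trans hr.2⟩
    have hmono : MonotoneOn (fun x => halfSlope a γ / 2 * x ^ 2 - x ^ 2 / F x) (Icc s r) := by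
      have hF0 : ∀ x ∈ Icc s r, F x ≠ 0 := fun x hx =>
        (h.F_pos ⟨hs.1.trans_le hx.1, hx.2.trans hr.2⟩).ne'
      have hc := h.F_cont.mono hsub
      have hdF := fun x (hx : x ∈ Ioo s r) =>
        h.hasDerivAt_F x ⟨hs.1.trans hx.1, hx.2.trans_le hr.2⟩
      refine monotoneOn_Icc_of_hasDerivAt
        (ContinuousOn.sub (by fun_prop) (ContinuousOn.div (by fun_prop) hc hF0))
        (fun x hx => ((hasDerivAt_pow 2 x).const_mul _).sub
          ((hasDerivAt_pow 2 x).div (hdF x hx) (hF0 x ⟨hx.1.le, hx.2.le⟩)))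
        fun x hx => ?_
      have hx0 : 0 < x := hs.1.trans hx.1
      have hFx := h.F_pos ⟨hx0, hx.2.le.trans hr.2⟩
      have hE := h.le_energy ⟨hx0.le, hx.2.le.trans hr.2⟩
      rw [sub_nonneg, div_le_iff₀ (by positivity)]
      have := mul_le_mul_of_nonneg_left hE hx0.le
      simp only [Nat.cast_ofNat, Nat.add_one_sub_one, pow_one]
      linarith
    have h1 := hmono ⟨le_rfl, hs.2.le⟩ ⟨hs.2.le, le_rfl⟩ hs.2.le
    have hFs := h.F_pos hsR
    have hus := h.u_pos ⟨hsR.1.le, hsR.2⟩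
    have h2 : s ^ 2 / F s ≤ 2 / (β * u s * exp (u s ^ 2 - a * u s)) := by
      rw [div_le_div_iff₀ hFs (by positivity)]
      exact h.energy_le ⟨hsR.1.le, hsR.2⟩
    have h3 : 0 ≤ halfSlope a γ / 2 * s ^ 2 := by positivity
    simp only at h1
    linarith
  have hlim : Tendsto (fun s => 2 / (β * u s * exp (u s ^ 2 - a * u s))) (𝓝[Ioo 0 r] 0)
      (𝓝 (2 / (β * u 0 * exp (u 0 ^ 2 - a * u 0)))) := by
    have hu : Tendsto u (𝓝[Ioo 0 r] 0) (𝓝 (u 0)) :=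
      ((h.u_cont 0 ⟨le_rfl, h.R_pos.le⟩).mono
        (Ioo_subset_Icc_self.trans (Icc_subset_Icc_right hr.2)))
    refine tendsto_const_nhds.div ((hu.const_mul β).mul
      ((continuous_exp.tendsto _).comp ((hu.pow 2).sub (hu.const_mul a)))) ?_
    rw [h.u_zero]
    positivity
  have : (𝓝[Ioo 0 r] (0 : ℝ)).NeBot := by
    rw [nhdsWithin_Ioo_eq_nhdsGT hr.1]
    infer_instance
  have h1 := ge_of_tendsto hlim (eventually_mem_nhdsWithin.mono key)
  have h2 : 2 / (β * u 0 * exp (u 0 ^ 2 - a * u 0)) = γ * μ ^ 2 / 2 := by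
    rw [h.u_zero, div_eq_div_iff (by positivity) two_ne_zero]
    linarith [h.scale]
  rw [h2, sub_le_iff_le_add, div_le_iff₀ hF] at h1
  rw [div_le_iff₀ (by positivity)]
  linarith

theorem u_le_sub (h : RadialProfile a c1 β γ μ R u F) {r : ℝ} (hr : r ∈ Icc 0 R) :
    u r ≤ γ - bubbleLog a γ μ r / halfSlope a γ := by
  have hγ := h.γ_pos
  have hμ := h.μ_pos
  have hM := h.halfSlope_pos
  have hmono : MonotoneOn (fun r => -u r - bubbleLog a γ μ r / halfSlope a γ) (Icc 0 R) := by
    refine monotoneOn_Icc_of_hasDerivAt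
      (h.u_cont.neg.sub (h.continuous_bubbleLog.div_const _).continuousOn)
      (fun r hr => (h.hasDerivAt_u r hr).neg.sub ((h.hasDerivAt_bubbleLog r).div_const _))
      fun r hr => ?_
    have hr0 := hr.1
    have := div_le_div_of_nonneg_right (h.le_F ⟨hr.1, hr.2.le⟩) hr0.le
    rw [neg_neg, sub_nonneg]
    refine le_trans (le_of_eq ?_) this
    field_simp
  have := hmono ⟨le_rfl, h.R_pos.le⟩ hr hr.1
  simp only [h.u_zero, bubbleLog_zero, zero_div] at this
  linarith

theorem bubbleLog_le (h : RadialProfile a c1 β γ μ R u F) {r : ℝ} (hr : r ∈ Icc 0 R) :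
    bubbleLog a γ μ r ≤ halfSlope a γ * (γ - c1) := by
  have h1 := h.u_le_sub hr
  have h2 := h.le_u r hr
  have h3 : bubbleLog a γ μ r / halfSlope a γ ≤ γ - c1 := by linarith
  rw [div_le_iff₀ h.halfSlope_pos] at h3
  linarith

theorem nonlinearity_le (h : RadialProfile a c1 β γ μ R u F) {r : ℝ} (hr : r ∈ Icc 0 R) :
    u r * exp (u r ^ 2 - a * u r) ≤ γ * exp (γ ^ 2 - a * γ) *
      exp (-2 * bubbleLog a γ μ r + bubbleLog a γ μ r ^ 2 / halfSlope a γ ^ 2) := by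
  have hγ := h.γ_pos
  have hM := h.halfSlope_pos
  have hu := h.u_pos hr
  have hc := h.le_u r hr
  have hle := h.u_le_sub hr
  have ha := h.half_lt
  set X := bubbleLog a γ μ r / halfSlope a γ with hX
  have hT : bubbleLog a γ μ r = halfSlope a γ * X := by rw [hX]; field_simp
  have h1 : u r / γ ≤ exp (-X / γ) := by
    refine le_trans ?_ (add_one_le_exp _)
    rw [div_le_iff₀ hγ, add_mul, div_mul_cancel₀ _ hγ.ne']
    linarith
  have h2 : u r ^ 2 - a * u r ≤ (γ - X) ^ 2 - a * (γ - X) := by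
    nlinarith [mul_nonneg (sub_nonneg.2 hle) (show 0 ≤ u r + (γ - X) - a by linarith)]
  calc u r * exp (u r ^ 2 - a * u r)
      = γ * (u r / γ) * exp (u r ^ 2 - a * u r) := by field_simp
    _ ≤ γ * exp (-X / γ) * exp ((γ - X) ^ 2 - a * (γ - X)) := by gcongr
    _ = _ := by
      have h3 : (halfSlope a γ * X) ^ 2 / halfSlope a γ ^ 2 = X ^ 2 := by field_simp
      rw [mul_assoc, mul_assoc, ← Real.exp_add, ← Real.exp_add, hT, h3]
      congr 2
      unfold halfSlope
      field_simp
      ring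

theorem F_deriv_le (h : RadialProfile a c1 β γ μ R u F) {r : ℝ} (hr : r ∈ Ioo 0 R) :
    r * (β * u r * exp (u r ^ 2 - a * u r)) ≤ 2 / halfSlope a γ *
      (exp (-bubbleLog a γ μ r + bubbleLog a γ μ r ^ 2 / halfSlope a γ ^ 2) *
        (2 * halfSlope a γ * r / (γ * μ ^ 2 + halfSlope a γ * r ^ 2))) := by
  have hγ := h.γ_pos
  have hM := h.halfSlope_pos
  have hμ := h.μ_pos
  have hr0 := hr.1
  have hβ := h.β_pos
  have h1 := h.nonlinearity_le (Ioo_subset_Icc_self hr)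
  have h2 := mul_le_mul_of_nonneg_left h1 (mul_pos hr0 hβ).le
  have hexp : exp (-2 * bubbleLog a γ μ r + bubbleLog a γ μ r ^ 2 / halfSlope a γ ^ 2) =
      exp (-bubbleLog a γ μ r + bubbleLog a γ μ r ^ 2 / halfSlope a γ ^ 2) /
        (1 + halfSlope a γ / γ * (r ^ 2 / μ ^ 2)) := by
    rw [← h.exp_bubbleLog, ← Real.exp_sub]
    congr 1
    ring
  have hs : β * (γ * exp (γ ^ 2 - a * γ)) = 4 / (μ ^ 2 * γ) := by
    rw [eq_div_iff (by positivity)]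
    linarith [h.scale]
  calc _ = r * β * (u r * exp (u r ^ 2 - a * u r)) := by ring
    _ ≤ _ := h2
    _ = r * (β * (γ * exp (γ ^ 2 - a * γ))) *
      exp (-2 * bubbleLog a γ μ r + bubbleLog a γ μ r ^ 2 / halfSlope a γ ^ 2) := by ring
    _ = _ := by
      rw [hexp, hs]
      field_simp
      ring

theorem F_sub_le (h : RadialProfile a c1 β γ μ R u F) {A κ p q : ℝ} (hp : 0 ≤ p) (hpq : p ≤ q)
    (hq : q ≤ R)
    (hb : ∀ s, bubbleLog a γ μ p ≤ s → s ≤ halfSlope a γ * (γ - c1) →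
      exp (-s + s ^ 2 / halfSlope a γ ^ 2) ≤ A * exp (-s) + κ) :
    F q - F p ≤ 2 / halfSlope a γ * (A * (exp (-bubbleLog a γ μ p) - exp (-bubbleLog a γ μ q)) +
      κ * (bubbleLog a γ μ q - bubbleLog a γ μ p)) := by
  have hγ := h.γ_pos
  have hM := h.halfSlope_pos
  have hμ := h.μ_pos
  have hsub : Icc p q ⊆ Icc 0 R := Icc_subset_Icc hp hq
  have hTc := h.continuous_bubbleLog
  have hTmono : MonotoneOn (bubbleLog a γ μ) (Icc p q) := by
    refine monotoneOn_Icc_of_hasDerivAt hTc.continuousOn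
      (fun r _ => h.hasDerivAt_bubbleLog r) fun r hr => ?_
    have : 0 < r := hp.trans_lt hr.1
    positivity
  have hmono : MonotoneOn (fun r => 2 / halfSlope a γ * (κ * bubbleLog a γ μ r -
      A * exp (-bubbleLog a γ μ r)) - F r) (Icc p q) := by
    have hF := h.F_cont.mono hsub
    refine monotoneOn_Icc_of_hasDerivAt (by fun_prop)
      (fun r hr => ((((h.hasDerivAt_bubbleLog r).const_mul κ).sub
        ((h.hasDerivAt_bubbleLog r).neg.exp.const_mul A)).const_mul _).sub
        (h.hasDerivAt_F r ⟨hp.trans_lt hr.1, hr.2.trans_le hq⟩)) fun r hr => ?_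
    have hr0 : r ∈ Ioo 0 R := ⟨hp.trans_lt hr.1, hr.2.trans_le hq⟩
    have hpos : 0 < r := hr0.1
    have h1 := hb _ (hTmono ⟨le_rfl, hpq⟩ ⟨hr.1.le, hr.2.le⟩ hr.1.le)
      (h.bubbleLog_le (Ioo_subset_Icc_self hr0))
    rw [sub_nonneg]
    refine (h.F_deriv_le hr0).trans ?_
    have h2 : 0 ≤ 2 * halfSlope a γ * r / (γ * μ ^ 2 + halfSlope a γ * r ^ 2) := by positivity
    have h3 := mul_le_mul_of_nonneg_right h1 h2
    refine mul_le_mul_of_nonneg_left (h3.trans (le_of_eq ?_)) (by positivity)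
    simp only [Pi.neg_apply]
    ring
  have := hmono ⟨le_rfl, hpq⟩ ⟨hpq, le_rfl⟩ hpq
  simp only at this
  linarith

theorem sub_le_u (h : RadialProfile a c1 β γ μ R u F) {η : ℝ}
    (hF : ∀ r ∈ Ioo 0 R,
      F r ≤ 2 / halfSlope a γ * ((1 + η) * (1 - exp (-bubbleLog a γ μ r))))
    {r : ℝ} (hr : r ∈ Icc 0 R) :
    γ - (1 + η) * (bubbleLog a γ μ r / halfSlope a γ) ≤ u r := by
  have hγ := h.γ_pos
  have hμ := h.μ_pos
  have hM := h.halfSlope_pos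
  have hmono : MonotoneOn (fun r => u r + (1 + η) * (bubbleLog a γ μ r / halfSlope a γ))
      (Icc 0 R) := by
    refine monotoneOn_Icc_of_hasDerivAt
      (h.u_cont.add ((h.continuous_bubbleLog.div_const _).const_mul _).continuousOn)
      (fun r hr => (h.hasDerivAt_u r hr).add
        (((h.hasDerivAt_bubbleLog r).div_const _).const_mul _))
      fun r hr => ?_
    have hr0 := hr.1
    have := div_le_div_of_nonneg_right (hF r hr) hr0.le
    rw [← sub_eq_neg_add, sub_nonneg]
    refine this.trans (le_of_eq ?_)
    rw [Real.exp_neg, h.exp_bubbleLog]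
    field_simp
    ring
  have := hmono ⟨le_rfl, h.R_pos.le⟩ hr hr.1
  simp only [h.u_zero, bubbleLog_zero, zero_div, mul_zero] at this
  linarith

end RadialProfile

theorem exists_flux {g : ℝ → ℝ} {b γ : ℝ} {u : ℝ → ℝ} (hu : IsGSol g b γ u) :
    ∃ F : ℝ → ℝ, ContinuousOn F (Icc 0 1) ∧ F 0 = 0 ∧
      (∀ r ∈ Ioo (0 : ℝ) 1, HasDerivAt u (-(F r / r)) r) ∧
      ∀ r ∈ Ioo (0 : ℝ) 1, HasDerivAt F (r * (b * u r * g (u r))) r := by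
  obtain ⟨hsmooth, heq, -⟩ := hu
  have hnhds : ∀ r ∈ Ioo (0 : ℝ) 1, Icc (0 : ℝ) 1 ∈ 𝓝 r := fun r hr => Icc_mem_nhds hr.1 hr.2
  have hdw : ∀ r ∈ Ioo (0 : ℝ) 1, derivWithin u (Icc 0 1) r = deriv u r := fun r hr =>
    derivWithin_of_mem_nhds (hnhds r hr)
  refine ⟨fun r => -r * derivWithin u (Icc 0 1) r, ?_, by simp, ?_, ?_⟩
  · have := hsmooth.continuousOn_derivWithin uniqueDiffOn_Icc_zero_one (by simp)
    fun_prop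
  · intro r hr
    have hr0 := hr.1.ne'
    have h1 := (hsmooth.contDiffAt (hnhds r hr)).differentiableAt (by simp)
    refine h1.hasDerivAt.congr_deriv ?_
    simp only [hdw r hr]
    field_simp
  · intro r hr
    have hr0 := hr.1.ne'
    have h1 : ContDiffOn ℝ 1 (deriv u) (Ioo 0 1) :=
      (hsmooth.mono Ioo_subset_Icc_self).deriv_of_isOpen isOpen_Ioo (right_eq_inf.mp rfl)
    have h2 := (hasDerivAt_id r).neg.mul
      ((h1.contDiffAt (isOpen_Ioo.mem_nhds hr)).differentiableAt (by simp)).hasDerivAt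
    have h3 : (fun r => -r * derivWithin u (Icc 0 1) r) =ᶠ[𝓝 r] (-id) * deriv u := by
      filter_upwards [isOpen_Ioo.mem_nhds hr] with x hx
      simp [hdw x hx]
    refine (h2.congr_of_eventuallyEq h3).congr_deriv ?_
    rw [← heq r hr, radLap]
    simp
    field_simp
    ring

theorem exists_radialProfile {a c0 c1 b γ μ R : ℝ} {g u : ℝ → ℝ} (hG : GCtx a c0 g)
    (hc : max c0 (a / 2) < c1) (hγ : c1 < γ) (hγ1 : 1 ≤ 2 * γ * c1) (hb : 0 < b)
    (hu : IsGSol g b γ u) (hμ : 0 < μ) (hscale : μ ^ 2 * b * γ ^ 2 * g γ = 4)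
    (hR : R ∈ Ioo (0 : ℝ) 1) (huR : u R = c1) :
    ∃ F : ℝ → ℝ, RadialProfile a c1 b γ μ R u F ∧
      ∀ r ∈ Ioo 0 R, radLap u r * r = r * (b * u r * exp (u r ^ 2 - a * u r)) := by
  obtain ⟨F, hFc, hF0, hu', hF'⟩ := exists_flux hu
  obtain ⟨hsmooth, heq, hpos, -, hu0⟩ := hu
  obtain ⟨-, hc0, -, hgpos, hg⟩ := hG
  have hc0' : c0 < c1 := (le_max_left _ _).trans_lt hc
  have hsub : Icc 0 R ⊆ Icc 0 1 := Icc_subset_Icc_right hR.2.le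
  have hF : MonotoneOn F (Icc 0 1) := by
    refine monotoneOn_Icc_of_hasDerivAt hFc hF' fun r hr => ?_
    have h1 := hpos r ⟨hr.1.le, hr.2⟩
    have h2 := hgpos _ h1.le
    have := hr.1
    positivity
  have hmono : MonotoneOn (fun r => -u r) (Icc 0 1) := by
    refine monotoneOn_Icc_of_hasDerivAt hsmooth.continuousOn.neg
      (fun r hr => (hu' r hr).neg) fun r hr => ?_
    have := hF ⟨le_rfl, zero_le_one⟩ ⟨hr.1.le, hr.2.le⟩ hr.1.le
    rw [hF0] at this
    have := hr.1
    rw [neg_neg]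
    positivity
  have hle : ∀ r ∈ Icc 0 R, c1 ≤ u r := fun r hr => by
    have := hmono (hsub hr) ⟨hR.1.le, hR.2.le⟩ hr.2
    simp only [huR] at this
    linarith
  have hgu : ∀ r ∈ Icc 0 R, g (u r) = exp (u r ^ 2 - a * u r) := fun r hr =>
    hg _ (hc0'.le.trans (hle r hr))
  refine ⟨F, ?_, fun r hr => ?_⟩
  · exact
      { c1_pos := hc0.trans hc0'
        half_lt := (le_max_right _ _).trans_lt hc
        c1_lt := hγ
        one_le := hγ1
        β_pos := hb
        μ_pos := hμ
        R_pos := hR.1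
        scale := by rw [← hg γ (hc0'.trans hγ).le]; exact hscale
        u_cont := hsmooth.continuousOn.mono hsub
        F_cont := hFc.mono hsub
        u_zero := hu0
        F_zero := hF0
        le_u := hle
        hasDerivAt_u := fun r hr => hu' r ⟨hr.1, hr.2.trans hR.2⟩
        hasDerivAt_F := fun r hr => by
          rw [← hgu r (Ioo_subset_Icc_self hr)]
          exact hF' r ⟨hr.1, hr.2.trans hR.2⟩ }
  · rw [heq r ⟨hr.1, hr.2.trans hR.2⟩, hgu r (Ioo_subset_Icc_self hr), mul_comm]

theorem exp_neg_add_sq_le {M d s : ℝ} (hM : 0 < M) (hd : 0 ≤ d) (hs0 : 0 ≤ s)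
    (hs : s ≤ M * (M - d)) :
    exp (-s + s ^ 2 / M ^ 2) ≤ exp (-(s / 2)) + exp (-(M * d / 2)) := by
  have hsq : s ^ 2 / M ^ 2 = s * (s / M ^ 2) := by ring
  rcases le_total s (M ^ 2 / 2) with h | h
  · have h1 : s / M ^ 2 ≤ 1 / 2 := by rw [div_le_iff₀ (by positivity)]; linarith
    have h2 : exp (-s + s ^ 2 / M ^ 2) ≤ exp (-(s / 2)) := by
      rw [exp_le_exp, hsq]
      nlinarith
    linarith [exp_pos (-(M * d / 2))]
  · have h1 : s / M ^ 2 ≤ 1 - d / M := by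
      rw [div_le_iff₀ (by positivity)]
      refine hs.trans (le_of_eq ?_)
      field_simp
    have h2 : exp (-s + s ^ 2 / M ^ 2) ≤ exp (-(M * d / 2)) := by
      rw [exp_le_exp, hsq]
      have h3 : s * (s / M ^ 2) ≤ s * (1 - d / M) := by gcongr
      have h4 : M ^ 2 / 2 * (d / M) ≤ s * (d / M) := by gcongr
      have h5 : M ^ 2 / 2 * (d / M) = M * d / 2 := by field_simp
      linarith
    linarith [exp_pos (-(s / 2))]

/-- Quantitative conditions on `γ` that hold for all large `γ`. -/
structure LargeParam (a c1 ε γ : ℝ) : Prop where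
  c1_lt : c1 < γ
  one_le : 1 ≤ 2 * γ * c1
  two_le : 2 ≤ γ
  a_le : a ≤ γ
  inv_le : 1 ≤ γ * a
  gap_le : c1 - a / 2 ≤ γ / 2
  log_sq_le : 256 * log γ ^ 2 / γ ≤ min (ε / 4) 1
  twelve_le : 12 ≤ ε * γ
  exp_le : 12 * γ ^ 3 * exp (-((c1 - a / 2) / 4 * γ)) ≤ ε

theorem eventually_largeParam {a c1 ε : ℝ} (ha : 0 < a) (hc : a / 2 < c1) (hε : 0 < ε) :
    ∀ᶠ γ in atTop, LargeParam a c1 ε γ := by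
  have hc1 : 0 < c1 := by linarith
  have hlog : Tendsto (fun γ : ℝ => 256 * log γ ^ 2 / γ) atTop (𝓝 0) := by
    have := (Real.tendsto_pow_log_div_mul_add_atTop 1 0 2 one_ne_zero).const_mul 256
    simpa [mul_div_assoc] using this
  have hexp : Tendsto (fun γ : ℝ => 12 * γ ^ 3 * exp (-((c1 - a / 2) / 4 * γ))) atTop (𝓝 0) := by
    have := (tendsto_rpow_mul_exp_neg_mul_atTop_nhds_zero (3 : ℕ)
      ((c1 - a / 2) / 4) (by linarith)).const_mul 12
    simpa only [mul_assoc, rpow_natCast, neg_mul, mul_zero] using this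
  filter_upwards [eventually_gt_atTop c1, eventually_ge_atTop (1 / (2 * c1)),
    eventually_ge_atTop 2, eventually_ge_atTop a, eventually_ge_atTop (1 / a),
    eventually_ge_atTop (2 * (c1 - a / 2)), eventually_ge_atTop (12 / ε),
    hlog.eventually_le_const (show (0 : ℝ) < min (ε / 4) 1 by positivity),
    hexp.eventually_le_const hε] with γ h1 h2 h3 h4 h5 h6 h7 h8 h9
  rw [div_le_iff₀ (by positivity)] at h2 h5 h7
  exact ⟨h1, by linarith, h3, h4, h5, by linarith, h8, by linarith, h9⟩

namespace LargeParam

variable {a c1 ε γ : ℝ}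

theorem γ_pos (h : LargeParam a c1 ε γ) : 0 < γ := by linarith [h.two_le]

theorem le_halfSlope (h : LargeParam a c1 ε γ) : γ / 2 ≤ halfSlope a γ := by
  have := h.γ_pos
  have : 0 < 1 / (2 * γ) := by positivity
  have := h.a_le
  unfold halfSlope
  linarith

theorem halfSlope_le (h : LargeParam a c1 ε γ) : halfSlope a γ ≤ γ := by
  have hγ := h.γ_pos
  have : 1 / (2 * γ) ≤ a / 2 := by
    rw [div_le_div_iff₀ (by positivity) two_pos]
    linarith [h.inv_le]
  unfold halfSlope
  linarith

theorem mul_sub_le (h : LargeParam a c1 ε γ) :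
    halfSlope a γ * (γ - c1) ≤ halfSlope a γ * (halfSlope a γ - (c1 - a / 2)) := by
  have hγ := h.γ_pos
  have hM := h.le_halfSlope
  have : 0 < 1 / (2 * γ) := by positivity
  refine mul_le_mul_of_nonneg_left ?_ (by linarith)
  unfold halfSlope
  linarith

theorem mul_sub_le_sq (h : LargeParam a c1 ε γ) (ha : 0 < a) (hc : a / 2 < c1) :
    halfSlope a γ * (γ - c1) ≤ γ ^ 2 := by
  have hM := h.halfSlope_le
  have h1 := h.c1_lt
  nlinarith [mul_le_mul_of_nonneg_right hM (show 0 ≤ γ - c1 by linarith)]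

theorem exp_gap_le (h : LargeParam a c1 ε γ) (hc : a / 2 < c1) :
    exp (-(halfSlope a γ * (c1 - a / 2) / 2)) ≤ exp (-((c1 - a / 2) / 4 * γ)) := by
  rw [exp_le_exp]
  have := mul_le_mul_of_nonneg_right h.le_halfSlope (show 0 ≤ c1 - a / 2 by linarith)
  linarith

theorem exp_neg_add_sq_le_add (h : LargeParam a c1 ε γ) (hc : a / 2 < c1)
    {s : ℝ} (hs0 : 0 ≤ s) (hs : s ≤ halfSlope a γ * (γ - c1)) :
    exp (-s + s ^ 2 / halfSlope a γ ^ 2) ≤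
      (1 + ε / (2 * γ)) * exp (-s) + ε / (6 * γ ^ 3) := by
  have hγ := h.γ_pos
  have hM := h.le_halfSlope
  have hM0 : 0 < halfSlope a γ := by linarith
  have hε : 0 < ε := by
    have := h.twelve_le
    by_contra hneg
    nlinarith
  have hlog : 0 ≤ log γ := Real.log_nonneg (by linarith [h.two_le])
  rcases le_total s (8 * log γ) with hsl | hsl
  · have h1 : s ^ 2 / halfSlope a γ ^ 2 ≤ 256 * log γ ^ 2 / γ / γ := by
      calc s ^ 2 / halfSlope a γ ^ 2 ≤ (8 * log γ) ^ 2 / (γ / 2) ^ 2 := by gcongr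
        _ = _ := by field_simp; ring
    have h2 : 256 * log γ ^ 2 / γ / γ ≤ ε / 4 / γ := by
      exact div_le_div_of_nonneg_right (h.log_sq_le.trans (min_le_left _ _)) hγ.le
    have h3 : 256 * log γ ^ 2 / γ / γ ≤ 1 := by
      rw [div_le_one hγ]
      exact (h.log_sq_le.trans (min_le_right _ _)).trans (by linarith [h.two_le])
    set x := s ^ 2 / halfSlope a γ ^ 2
    have hx0 : 0 ≤ x := by positivity
    have h4 : exp x ≤ 1 + 2 * x := by
      have := Real.abs_exp_sub_one_le (x := x) (by rw [abs_of_nonneg hx0]; linarith)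
      rw [abs_of_nonneg hx0] at this
      linarith [le_abs_self (exp x - 1)]
    have h5 : ε / 4 / γ = ε / (2 * γ) / 2 := by field_simp; norm_num
    rw [Real.exp_add, mul_comm]
    have h6 : exp x ≤ 1 + ε / (2 * γ) := by linarith
    have h7 := mul_le_mul_of_nonneg_right h6 (exp_pos (-s)).le
    have : 0 < ε / (6 * γ ^ 3) := by positivity
    linarith
  · have h1 := exp_neg_add_sq_le hM0 (show 0 ≤ c1 - a / 2 by linarith) hs0
      (hs.trans h.mul_sub_le)
    have h2 : exp (-(s / 2)) ≤ ε / (12 * γ ^ 3) := by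
      calc exp (-(s / 2)) ≤ exp (-(4 * log γ)) := by gcongr; linarith
        _ = 1 / γ ^ 4 := by
          rw [Real.exp_neg, show 4 * log γ = ((4 : ℕ) : ℝ) * log γ by norm_num, Real.exp_nat_mul,
            Real.exp_log hγ, one_div]
        _ ≤ _ := by
          rw [div_le_div_iff₀ (by positivity) (by positivity)]
          have := mul_le_mul_of_nonneg_right h.twelve_le (show 0 ≤ γ ^ 3 by positivity)
          linarith
    have h3 : exp (-((c1 - a / 2) / 4 * γ)) ≤ ε / (12 * γ ^ 3) := by
      rw [le_div_iff₀ (by positivity)]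
      linarith [h.exp_le]
    have h4 : ε / (6 * γ ^ 3) = ε / (12 * γ ^ 3) + ε / (12 * γ ^ 3) := by field_simp; norm_num
    have h5 : 0 < (1 + ε / (2 * γ)) * exp (-s) := by positivity
    linarith [h.exp_gap_le hc]

theorem linear_add_le (h : LargeParam a c1 ε γ) (ha : 0 < a) (hc : a / 2 < c1)
    {s : ℝ} (hs0 : 0 ≤ s) (hs : s ≤ halfSlope a γ * (γ - c1)) :
    (1 + ε / (2 * γ)) * (1 - exp (-s)) + ε / (6 * γ ^ 3) * s ≤
      (1 + ε / γ) * (1 - exp (-s)) := by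
  have hγ := h.γ_pos
  have hε : 0 < ε := by
    have := h.twelve_le
    by_contra hneg
    nlinarith
  have hs2 : s ≤ γ ^ 2 := hs.trans (h.mul_sub_le_sq ha hc)
  have h1 : exp (-s) ≤ 1 / (1 + s) := by
    rw [Real.exp_neg, ← one_div]
    exact one_div_le_one_div_of_le (by positivity) (by linarith [add_one_le_exp s])
  have h2 : s / (3 * γ ^ 2) ≤ 1 - exp (-s) := by
    have : 1 - 1 / (1 + s) = s / (1 + s) := by field_simp; ring
    have h3 : s / (3 * γ ^ 2) ≤ s / (1 + s) := by
      gcongr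
      nlinarith [h.two_le]
    linarith
  have h3 := mul_le_mul_of_nonneg_left h2 (show 0 ≤ ε / (2 * γ) by positivity)
  have h4 : ε / (2 * γ) * (s / (3 * γ ^ 2)) = ε / (6 * γ ^ 3) * s := by field_simp; ring
  have h5 : ε / γ = ε / (2 * γ) + ε / (2 * γ) := by field_simp; norm_num
  rw [h5]
  linarith

end LargeParam

namespace RadialProfile

variable {a c1 β γ μ R ε : ℝ} {u F : ℝ → ℝ}

theorem abs_u_sub_le (h : RadialProfile a c1 β γ μ R u F) (hL : LargeParam a c1 ε γ)
    (ha : 0 < a) {r : ℝ} (hr : r ∈ Icc 0 R) :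
    |u r - (γ - bubbleLog a γ μ r / halfSlope a γ)| ≤
      ε / γ * (bubbleLog a γ μ r / halfSlope a γ) := by
  have h1 := h.u_le_sub hr
  have h2 := h.sub_le_u (η := ε / γ) (fun x hx => by
    have h3 := h.F_sub_le le_rfl hx.1.le hx.2.le fun s hs0 hs =>
      hL.exp_neg_add_sq_le_add h.half_lt (bubbleLog_zero.symm.le.trans hs0) hs
    rw [h.F_zero, bubbleLog_zero, neg_zero, Real.exp_zero, sub_zero, sub_zero] at h3
    refine h3.trans ?_
    have := h.halfSlope_pos
    gcongr
    exact hL.linear_add_le ha h.half_lt (h.bubbleLog_nonneg x)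
      (h.bubbleLog_le (Ioo_subset_Icc_self hx))) hr
  have h3 := h.halfSlope_pos
  have h4 := h.bubbleLog_nonneg r
  rw [abs_le]
  constructor <;> linarith

theorem abs_bubbleLog_sub_tG_le (h : RadialProfile a c1 β γ μ R u F) (hL : LargeParam a c1 ε γ)
    (r : ℝ) : |bubbleLog a γ μ r - tG μ r| ≤ 1 := by
  have hγ := h.γ_pos
  have hμ := h.μ_pos
  have hM := h.halfSlope_pos
  have h1 : halfSlope a γ / γ ≤ 1 := (div_le_one hγ).2 (hL.halfSlope_le)
  have h2 : 1 / 2 ≤ halfSlope a γ / γ := by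
    rw [le_div_iff₀ hγ]
    linarith [hL.le_halfSlope]
  have hx : 0 ≤ r ^ 2 / μ ^ 2 := by positivity
  have h3 : bubbleLog a γ μ r ≤ tG μ r := by
    apply Real.log_le_log (h.arg_pos r)
    nlinarith
  have h4 : tG μ r ≤ bubbleLog a γ μ r + log 2 := by
    rw [bubbleLog, ← Real.log_mul (h.arg_pos r).ne' two_ne_zero]
    apply Real.log_le_log (by positivity)
    nlinarith
  have h5 : log 2 ≤ 1 := by linarith [Real.log_two_lt_d9]
  rw [abs_le]
  constructor <;> linarith

theorem F_sub_le_exp (h : RadialProfile a c1 β γ μ R u F) (hL : LargeParam a c1 ε γ)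
    (ha : 0 < a) {p : ℝ} (hp : 0 ≤ p) (hpR : p ≤ R) (ht : tG μ p = γ ^ 2 / 2) :
    F R - F p ≤ 64 / (c1 - a / 2) * exp (-((c1 - a / 2) / 8) * γ) := by
  have hγ := h.γ_pos
  have hM := h.halfSlope_pos
  have hd : 0 < c1 - a / 2 := by linarith [h.half_lt]
  have hTp : γ ^ 2 / 4 ≤ bubbleLog a γ μ p := by
    have := (abs_le.1 (h.abs_bubbleLog_sub_tG_le hL p)).1
    rw [ht] at this
    nlinarith [hL.two_le]
  have h1 := h.F_sub_le (A := 0) (κ := 2 * exp (-((c1 - a / 2) / 4 * γ))) hp hpR le_rfl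
    fun s hs0 hs => by
      have hs1 := hTp.trans hs0
      have h2 := exp_neg_add_sq_le hM hd.le ((by positivity : 0 ≤ γ ^ 2 / 4).trans hs1)
        (hs.trans hL.mul_sub_le)
      have h3 : exp (-(s / 2)) ≤ exp (-((c1 - a / 2) / 4 * γ)) := by
        rw [exp_le_exp]
        nlinarith [hL.gap_le]
      linarith [hL.exp_gap_le h.half_lt]
  have h2 : bubbleLog a γ μ R - bubbleLog a γ μ p ≤ γ ^ 2 := by
    have := h.bubbleLog_le (r := R) ⟨h.R_pos.le, le_rfl⟩
    have := hL.mul_sub_le_sq ha h.half_lt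
    have := h.bubbleLog_nonneg p
    linarith
  have h3 : 2 / halfSlope a γ ≤ 4 / γ := by
    rw [div_le_div_iff₀ hM hγ]
    linarith [hL.le_halfSlope]
  have h4 : γ ≤ 8 / (c1 - a / 2) * exp ((c1 - a / 2) / 8 * γ) := by
    have h5 := mul_le_mul_of_nonneg_left
      ((le_add_of_nonneg_right zero_le_one).trans (add_one_le_exp ((c1 - a / 2) / 8 * γ)))
      (show 0 ≤ 8 / (c1 - a / 2) by positivity)
    rwa [← mul_assoc, div_mul_div_cancel₀ hd.ne', div_self (by norm_num), one_mul] at h5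
  rw [zero_mul, zero_add] at h1
  calc F R - F p ≤ _ := h1
    _ ≤ 2 / halfSlope a γ * (2 * exp (-((c1 - a / 2) / 4 * γ)) * γ ^ 2) := by gcongr
    _ ≤ 4 / γ * (2 * exp (-((c1 - a / 2) / 4 * γ)) * γ ^ 2) := by gcongr
    _ = 8 * exp (-((c1 - a / 2) / 4 * γ)) * γ := by field_simp; norm_num
    _ ≤ 8 * exp (-((c1 - a / 2) / 4 * γ)) *
        (8 / (c1 - a / 2) * exp ((c1 - a / 2) / 8 * γ)) := by gcongr
    _ = 64 / (c1 - a / 2) *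
        (exp (-((c1 - a / 2) / 4 * γ)) * exp ((c1 - a / 2) / 8 * γ)) := by ring
    _ = _ := by
      rw [← Real.exp_add]
      congr 2
      ring

theorem integral_radLap (h : RadialProfile a c1 β γ μ R u F)
    (hlap : ∀ r ∈ Ioo 0 R, radLap u r * r = r * (β * u r * exp (u r ^ 2 - a * u r)))
    {p : ℝ} (hp : 0 ≤ p) (hpR : p ≤ R) :
    ∫ r in Ioo p R, radLap u r * (2 * π * r) = 2 * π * (F R - F p) := by
  have hsub : Icc p R ⊆ Icc 0 R := Icc_subset_Icc_left hp
  have h1 : ∫ r in p..R, r * (β * u r * exp (u r ^ 2 - a * u r)) = F R - F p := by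
    have hu := h.u_cont.mono hsub
    refine intervalIntegral.integral_eq_sub_of_hasDerivAt_of_le hpR (h.F_cont.mono hsub)
      (fun r hr => h.hasDerivAt_F r ⟨hp.trans_lt hr.1, hr.2⟩) ?_
    refine ContinuousOn.intervalIntegrable ?_
    rw [uIcc_of_le hpR]
    fun_prop
  rw [← h1, intervalIntegral.integral_of_le hpR, integral_Ioc_eq_integral_Ioo,
    ← integral_const_mul]
  refine setIntegral_congr_fun measurableSet_Ioo fun r hr => ?_
  rw [← hlap r ⟨hp.trans_lt hr.1, hr.2⟩]
  ring

end RadialProfile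

theorem LargeParam.abs_inv_halfSlope_sub_le {a c1 ε γ : ℝ} (hL : LargeParam a c1 ε γ)
    (ha : 0 < a) :
    |1 / halfSlope a γ - 1 / γ * (1 + a / (2 * γ))| ≤ (1 + a ^ 2) / γ ^ 3 := by
  have hγ := hL.γ_pos
  have hM := hL.le_halfSlope
  have hM' := hL.halfSlope_le
  have hM0 : 0 < halfSlope a γ := by linarith
  have h1 : 1 / halfSlope a γ - 1 / γ * (1 + a / (2 * γ)) =
      (a * (γ - halfSlope a γ) - 1) / 2 / (halfSlope a γ * γ ^ 2) := by
    have : halfSlope a γ * (2 * γ) = 2 * γ ^ 2 - a * γ + 1 := by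
      unfold halfSlope
      field_simp
    field_simp
    linear_combination -this
  have h2 : |(a * (γ - halfSlope a γ) - 1) / 2| ≤ (1 + a ^ 2) / 2 := by
    have h3 : γ - halfSlope a γ ≤ a := by
      have : 0 < 1 / (2 * γ) := by positivity
      unfold halfSlope
      linarith
    have h4 := mul_le_mul_of_nonneg_left h3 ha.le
    have h5 := mul_nonneg ha.le (sub_nonneg.2 hM')
    rw [abs_le]
    constructor <;> nlinarith
  rw [h1, abs_div, abs_of_pos (show 0 < halfSlope a γ * γ ^ 2 by positivity)]
  calc _ ≤ (1 + a ^ 2) / 2 / (γ / 2 * γ ^ 2) := by gcongr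
    _ = _ := by field_simp

theorem tG_mono_s16 {μ p r : ℝ} (hp : 0 ≤ p) (hpr : p ≤ r) : tG μ p ≤ tG μ r := by
  unfold tG
  gcongr

theorem RadialProfile.abs_u_sub_tG_le {a c1 β γ μ R ε : ℝ} {u F : ℝ → ℝ}
    (h : RadialProfile a c1 β γ μ R u F) (hL : LargeParam a c1 (ε / 16) γ) (ha : 0 < a)
    (hε : 0 < ε) (hε4 : 8 / γ ≤ ε / 2) (hεa : (1 + a ^ 2) / γ ≤ ε / 4) {r : ℝ}
    (hr : r ∈ Icc 0 R) (ht : γ ^ 2 / 2 ≤ tG μ r) :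
    |u r - (γ - tG μ r / γ * (1 + a / (2 * γ)))| ≤ ε * tG μ r / γ ^ 2 := by
  have hγ := h.γ_pos
  have hM := hL.le_halfSlope
  have hM0 := h.halfSlope_pos
  have h1 := h.abs_u_sub_le hL ha hr
  have h2 := h.abs_bubbleLog_sub_tG_le hL r
  have h3 := hL.abs_inv_halfSlope_sub_le ha
  set T := bubbleLog a γ μ r
  set t := tG μ r
  set M := halfSlope a γ
  have ht1 : 1 ≤ t := by nlinarith [hL.two_le]
  have hT : T ≤ 2 * t := by linarith [(abs_le.1 h2).2]
  have e1 : ε / 16 / γ * (T / M) ≤ ε / 4 * (t / γ ^ 2) := by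
    calc ε / 16 / γ * (T / M) ≤ ε / 16 / γ * (2 * t / (γ / 2)) := by gcongr
      _ = _ := by field_simp; norm_num
  have e2 : |(T - t) / M| ≤ ε / 4 * (t / γ ^ 2) := by
    rw [abs_div, abs_of_pos hM0]
    calc |T - t| / M ≤ 1 / (γ / 2) := by gcongr
      _ = 4 / γ * (γ ^ 2 / 2 / γ ^ 2) := by field_simp; norm_num
      _ ≤ 4 / γ * (t / γ ^ 2) := by gcongr
      _ ≤ _ := by
        have : 8 / γ = 2 * (4 / γ) := by ring
        exact mul_le_mul_of_nonneg_right (by linarith) (by positivity)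
  have e3 : |t * (1 / M - 1 / γ * (1 + a / (2 * γ)))| ≤ ε / 4 * (t / γ ^ 2) := by
    rw [abs_mul, abs_of_nonneg (by linarith : 0 ≤ t)]
    calc _ ≤ t * ((1 + a ^ 2) / γ ^ 3) := by gcongr
      _ = (1 + a ^ 2) / γ * (t / γ ^ 2) := by field_simp
      _ ≤ _ := by gcongr
  have hsplit : u r - (γ - t / γ * (1 + a / (2 * γ))) = (u r - (γ - T / M)) -
      ((T - t) / M + t * (1 / M - 1 / γ * (1 + a / (2 * γ)))) := by ring
  have hpos : 0 ≤ t / γ ^ 2 := by positivity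
  rw [hsplit]
  refine (abs_sub _ _).trans ?_
  have := abs_add_le ((T - t) / M) (t * (1 / M - 1 / γ * (1 + a / (2 * γ))))
  have hfin : ε * t / γ ^ 2 = ε * (t / γ ^ 2) := by ring
  have := mul_nonneg hε.le hpos
  linarith

/-- Fix c₁ > max(c₀, a/2) and let r_γ ∈ (0,1) be the radius with
u_γ(r_γ) = c₁ (γ > c₁). Then, as γ → +∞,
u_γ(r) = γ − (t_γ(r)/γ)(1 + a/(2γ)) + o(t_γ(r)/γ²) uniformly on [ρ_γ, r_γ], and there
exists δ > 0 with ∫_{B₀(r_γ)∖B₀(ρ_γ)} Δu_γ dy = O(e^{−δγ}). -/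
theorem statement16 (a c0 : ℝ) (g : ℝ → ℝ) (hG : GCtx a c0 g)
    (β : ℝ → ℝ) (u : ℝ → ℝ → ℝ)
    (hsol : ∀ γ : ℝ, 0 < γ → 0 < β γ ∧ IsGSol g (β γ) γ (u γ))
    (μ : ℝ → ℝ)
    (hμ : ∀ γ : ℝ, 0 < γ → 0 < μ γ ∧ (μ γ) ^ 2 * β γ * γ ^ 2 * g γ = 4)
    (ρ : ℝ → ℝ)
    (hρ : ∀ γ : ℝ, 0 < γ → 0 < ρ γ ∧ tG (μ γ) (ρ γ) = γ ^ 2 / 2)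
    (c1 : ℝ) (hc1 : max c0 (a / 2) < c1)
    (rr : ℝ → ℝ)
    (hrr : ∀ γ : ℝ, c1 < γ → rr γ ∈ Set.Ioo (0:ℝ) 1 ∧ u γ (rr γ) = c1) :
    (∀ ε : ℝ, 0 < ε → ∀ᶠ γ in atTop, ∀ r ∈ Set.Icc (ρ γ) (rr γ),
      |u γ r - (γ - tG (μ γ) r / γ * (1 + a / (2 * γ)))|
        ≤ ε * tG (μ γ) r / γ ^ 2) ∧
    (∃ δ : ℝ, 0 < δ ∧ ∃ C : ℝ, ∀ᶠ γ in atTop,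
      |∫ r in Set.Ioo (ρ γ) (rr γ), radLap (u γ) r * (2 * π * r)|
        ≤ C * Real.exp (-δ * γ)) := by
  obtain ⟨ha, hc0, -⟩ := id hG
  have hc : a / 2 < c1 := (le_max_right _ _).trans_lt hc1
  have hprofile : ∀ ε γ, LargeParam a c1 ε γ → ∃ F : ℝ → ℝ,
      RadialProfile a c1 (β γ) γ (μ γ) (rr γ) (u γ) F ∧ ∀ r ∈ Ioo 0 (rr γ),
        radLap (u γ) r * r = r * (β γ * u γ r * exp (u γ r ^ 2 - a * u γ r)) :=
    fun ε γ hL => exists_radialProfile hG hc1 hL.c1_lt hL.one_le (hsol γ hL.γ_pos).1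
      (hsol γ hL.γ_pos).2 (hμ γ hL.γ_pos).1 (hμ γ hL.γ_pos).2 (hrr γ hL.c1_lt).1
      (hrr γ hL.c1_lt).2
  refine ⟨fun ε hε => ?_, (c1 - a / 2) / 8, by linarith, 2 * π * (64 / (c1 - a / 2)), ?_⟩
  · filter_upwards [eventually_largeParam ha hc (show 0 < ε / 16 by positivity),
      (tendsto_const_nhds.div_atTop tendsto_id).eventually_le_const
        (show (0 : ℝ) < ε / 2 by positivity),
      (tendsto_const_nhds.div_atTop tendsto_id).eventually_le_const
        (show (0 : ℝ) < ε / 4 by positivity)] with γ hL h4 ha4 r hr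
    obtain ⟨F, h, -⟩ := hprofile _ γ hL
    obtain ⟨hρ0, hρt⟩ := hρ γ hL.γ_pos
    exact h.abs_u_sub_tG_le hL ha hε h4 ha4 ⟨hρ0.le.trans hr.1, hr.2⟩
      (hρt ▸ tG_mono_s16 hρ0.le hr.1)
  · have hd : 0 < c1 - a / 2 := by linarith
    filter_upwards [eventually_largeParam ha hc one_pos] with γ hL
    obtain ⟨F, h, hlap⟩ := hprofile _ γ hL
    obtain ⟨hρ0, hρt⟩ := hρ γ hL.γ_pos
    rcases lt_or_ge (rr γ) (ρ γ) with hlt | hle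
    · rw [Ioo_eq_empty_of_le hlt.le, setIntegral_empty, abs_zero]
      positivity
    · have hnonneg := h.F_strictMono.monotoneOn ⟨hρ0.le, hle⟩ ⟨h.R_pos.le, le_rfl⟩ hle
      rw [h.integral_radLap hlap hρ0.le hle, abs_of_nonneg
        (mul_nonneg (by positivity) (sub_nonneg.2 hnonneg)), mul_assoc (2 * π)]
      gcongr
      exact h.F_sub_le_exp hL ha hρ0.le hle hρt

end
end
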